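/- Let 𝒮 = {T_1,…,T_m} be a finite collection of piecewise C² uniformly expanding maps of [0,1] whose transfer-operator cocycle (P_ω^n) with respect to Lebesgue measure m satisfies (LY), (Dec) and (Min) on BV, let Ω := {1,…,m}^ℤ carry the Bernoulli measure 𝐏 := (p_1,…,p_m)^{⊗ℤ} (all p_i > 0) with left shift σ, and T_ω^n := T_{ω_{n−1}} ∘ ⋯ ∘ T_{ω_0}. Let (h_ω) be the unique equivariant family of BV probability densities with P_ω h_ω = h_{σω}, ν^ω := h_ω·m, ν := ∫_Ω ν^ω d𝐏. Fix α ∈ (0,2) and x0 ∈ [0,1] such that every T_ω^n is continuous at x0 and T_ω^n(x0) ≠ x0 for all ω, n ≥ 1. Let φ(x) := |x − x0|^{−1/α}, b := lim_{ε→0⁺} ε^{−1} ν({x : |x−x0| < ε}) (which exists, is positive), and b_n := (bn)^{1/α}. Let R = ⋃_{i=1}^k (s_i, t_i] × J_i be a finite union of disjoint rectangles with 0 ≤ s_i < t_i and J_i = ⋃_l (u_{i,l}, v_{i,l}] finite disjoint unions of intervals with 0 < u_{i,l} < v_{i,l} ≤ ∞, and set Π_α(J_i) := Σ_l (u_{i,l}^{−α}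 − v_{i,l}^{−α}). Define N_n^ω(R)(x) := #{ j ≥ 1 : (j/n, φ(T_ω^{j−1}(x))/b_n) ∈ R }. Then for 𝐏-a.e. ω: (a) lim_{n→∞} ν^ω( { x : N_n^ω(R)(x) = 0 } ) = exp( − Σ_{i=1}^k (t_i − s_i) Π_α(J_i) ); and (b) lim_{n→∞} ∫ N_n^ω(R) dν^ω = Σ_{i=1}^k (t_i − s_i) Π_α(J_i). -/

import Mathlib

open MeasureTheory Filter Set Topology ENNReal

noncomputable section

/-- The two-sided shift space on `m` symbols. -/
abbrev Om (m : ℕ) := ℤ → Fin m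

/-- The left shift on the two-sided shift space. -/
def shift {m : ℕ} (ω : Om m) : Om m := fun i => ω (i + 1)

/-- Lebesgue measure on `[0,1]`. -/
def mLeb : Measure ℝ := volume.restrict (Set.Icc 0 1)

/-- `T` is a piecewise `C²` uniformly expanding map of `[0,1]` with expansion constant `lam`. -/
def PiecewiseC2Expanding (T : ℝ → ℝ) (lam : ℝ) : Prop :=
  ∃ (N : ℕ) (a : ℕ → ℝ), 1 ≤ N ∧ a 0 = 0 ∧ a N = 1 ∧ (∀ i < N, a i < a (i + 1)) ∧
    ∀ i < N, ∃ g : ℝ → ℝ,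
      ContDiffOn ℝ 2 g (Set.Icc (a i) (a (i + 1))) ∧
      Set.EqOn T g (Set.Ioo (a i) (a (i + 1))) ∧
      (StrictMonoOn g (Set.Icc (a i) (a (i + 1))) ∨
        StrictAntiOn g (Set.Icc (a i) (a (i + 1)))) ∧
      ∀ x ∈ Set.Icc (a i) (a (i + 1)),
        lam ≤ |derivWithin g (Set.Icc (a i) (a (i + 1))) x|

/-- The random composition `T_ω^n = T_{ω_{n−1}} ∘ ⋯ ∘ T_{ω_0}`. -/
def randComp {m : ℕ} (T : Fin m → ℝ → ℝ) (ω : Om m) : ℕ → ℝ → ℝ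
  | 0 => fun x => x
  | n + 1 => fun x => T (ω (n : ℤ)) (randComp T ω n x)

/-- The transfer-operator cocycle `P_ω^n = P_{σ^{n−1}ω} ∘ ⋯ ∘ P_ω`. -/
def Pcomp {m : ℕ} (Pop : Fin m → (ℝ → ℝ) → ℝ → ℝ) (ω : Om m) : ℕ → (ℝ → ℝ) → ℝ → ℝ
  | 0 => fun f => f
  | n + 1 => fun f => Pop (ω (n : ℤ)) (Pcomp Pop ω n f)

/-- The total variation of `f` on `[0,1]`. -/
def var (f : ℝ → ℝ) : ℝ := (eVariationOn f (Set.Icc 0 1)).toReal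

/-- The BV norm `‖f‖_BV = ‖f‖_{L¹(m)} + var(f)` on `[0,1]`. -/
def BVnorm (f : ℝ → ℝ) : ℝ := (∫ x, |f x| ∂mLeb) + var f

/-- `f` is of bounded variation on `[0,1]` (and integrable). -/
def IsBV (f : ℝ → ℝ) : Prop :=
  Integrable f mLeb ∧ BoundedVariationOn f (Set.Icc 0 1)

/-- The observable `φ(x) = |x − x0|^{−1/α}`. -/
def phiObs (α x0 x : ℝ) : ℝ := |x - x0| ^ (-α⁻¹)

/-- Membership in `J = ⋃_i (u_i, v_i]` (with `v_i = ∞` allowed). -/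
def memJ {q : ℕ} (u : Fin q → ℝ) (v : Fin q → ℝ≥0∞) (y : ℝ) : Prop :=
  ∃ i, u i < y ∧ ENNReal.ofReal y ≤ v i

/-- `Π_α(J) = Σ_i (u_i^{−α} − v_i^{−α})`. -/
def PiAlpha (α : ℝ) {q : ℕ} (u : Fin q → ℝ) (v : Fin q → ℝ≥0∞) : ℝ :=
  ∑ i, ((u i) ^ (-α) - ((v i).toReal) ^ (-α))

/-- The set `A_n = φ^{−1}(b_n J) = {x : φ(x)/b_n ∈ J}`. -/
def Aset (α x0 bn : ℝ) {q : ℕ} (u : Fin q → ℝ) (v : Fin q → ℝ≥0∞) : Set ℝ :=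
  {x | memJ u v (phiObs α x0 x / bn)}

/-- The survival event `{x : R_A(ω)(x) > N}`. -/
def survSet {m : ℕ} (T : Fin m → ℝ → ℝ) (ω : Om m) (A : Set ℝ) (N : ℕ) : Set ℝ :=
  {x | ∀ k : ℕ, 1 ≤ k → k ≤ N → randComp T ω k x ∉ A}

/-- Membership in the finite union of rectangles `R = ⋃_i (s_i, t_i] × J_i`. -/
def inRect (k : ℕ) (ss tt : Fin k → ℝ) (q : Fin k → ℕ)
    (u : ∀ i, Fin (q i) → ℝ) (v : ∀ i, Fin (q i) → ℝ≥0∞) (τ y : ℝ) : Prop :=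
  ∃ i, ss i < τ ∧ τ ≤ tt i ∧ memJ (u i) (v i) y

noncomputable section

instance mLeb_prob : IsProbabilityMeasure mLeb := by
  refine ⟨?_⟩
  simp [mLeb]

lemma mLeb_ae_mem : ∀ᵐ x ∂mLeb, x ∈ Set.Icc (0:ℝ) 1 := by
  unfold mLeb
  exact ae_restrict_mem measurableSet_Icc

lemma eVar_add_le (f g : ℝ → ℝ) (s : Set ℝ) :
    eVariationOn (fun x => f x + g x) s ≤ eVariationOn f s + eVariationOn g s := by
  unfold eVariationOn
  apply iSup_le
  rintro ⟨n, ⟨u, hu, us⟩⟩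
  calc ∑ i ∈ Finset.range n, edist (f (u (i + 1)) + g (u (i+1))) (f (u i) + g (u i))
      ≤ ∑ i ∈ Finset.range n, (edist (f (u (i + 1))) (f (u i)) + edist (g (u (i+1))) (g (u i))) :=
        Finset.sum_le_sum fun i _ => edist_add_add_le _ _ _ _
    _ = _ := Finset.sum_add_distrib
    _ ≤ _ := add_le_add (eVariationOn.sum_le hu us) (eVariationOn.sum_le hu us)

lemma eVar_neg (f : ℝ → ℝ) (s : Set ℝ) :
    eVariationOn (fun x => - f x) s = eVariationOn f s := by
  unfold eVariationOn
  simp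

lemma eVar_sub_le (f g : ℝ → ℝ) (s : Set ℝ) :
    eVariationOn (fun x => f x - g x) s ≤ eVariationOn f s + eVariationOn g s := by
  simpa [sub_eq_add_neg, eVar_neg] using eVar_add_le f (fun x => - g x) s

lemma eVar_sum_le {ι : Type*} (t : Finset ι) (f : ι → ℝ → ℝ) (s : Set ℝ) :
    eVariationOn (fun x => ∑ i ∈ t, f i x) s ≤ ∑ i ∈ t, eVariationOn (f i) s := by
  classical
  induction t using Finset.induction_on with
  | empty =>
    simp only [Finset.sum_empty, nonpos_iff_eq_zero]
    exact eVariationOn.constant_on (by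
      rintro _ ⟨x, _, rfl⟩ _ ⟨y, _, rfl⟩; rfl)
  | insert a t ha ih =>
    simp only [Finset.sum_insert ha]
    exact (eVar_add_le _ _ _).trans (by gcongr)

lemma eVar_const (c : ℝ) (s : Set ℝ) : eVariationOn (fun _ => c) s = 0 :=
  eVariationOn.constant_on (by rintro _ ⟨x, _, rfl⟩ _ ⟨y, _, rfl⟩; rfl)

lemma eVar_step_le (f : ℝ → ℝ) (hf : Monotone f) (h0 : ∀ x, 0 ≤ f x) (h1 : ∀ x, f x ≤ 1) :
    eVariationOn f (Icc 0 1) ≤ 1 := by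
  have := (hf.monotoneOn (Icc 0 1)).eVariationOn_le (a := 0) (b := 1) (by simp) (by simp)
  simp only [inter_self] at this
  refine this.trans ?_
  rw [ENNReal.ofReal_le_one]
  linarith [h0 0, h1 1]

lemma eVar_Ioo_le (a b : ℝ) :
    eVariationOn ((Ioo a b).indicator (fun _ => (1:ℝ))) (Icc 0 1) ≤ 2 := by
  by_cases hab : a < b
  · have h : (Ioo a b).indicator (fun _ => (1:ℝ)) =
        fun x => (Ioi a).indicator (fun _ => (1:ℝ)) x - (Ici b).indicator (fun _ => (1:ℝ)) x := by
      ext x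
      simp only [indicator, mem_Ioo, mem_Ioi, mem_Ici]
      split_ifs <;> grind
    rw [h]
    refine (eVar_sub_le _ _ _).trans ?_
    rw [← one_add_one_eq_two]
    gcongr
    · apply eVar_step_le
      · intro x y hxy
        simp only [indicator, mem_Ioi]
        split_ifs <;> grind
      · intro x; simp only [indicator]; split_ifs <;> simp
      · intro x; simp only [indicator]; split_ifs <;> simp
    · apply eVar_step_le
      · intro x y hxy
        simp only [indicator, mem_Ici]
        split_ifs <;> grind
      · intro x; simp only [indicator]; split_ifs <;> simp
      · intro x; simp only [indicator]; split_ifs <;> simp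
  · rw [Ioo_eq_empty hab]
    simp [eVar_const]

/-- punctured ball -/
def Dset (x0 r : ℝ) : Set ℝ := Ioo (x0 - r) x0 ∪ Ioo x0 (x0 + r)

lemma mem_Dset {x0 r x : ℝ} : x ∈ Dset x0 r ↔ x ≠ x0 ∧ |x - x0| < r := by
  simp only [Dset, mem_union, mem_Ioo, abs_lt]
  constructor
  · rintro (h | h)
    · exact ⟨h.2.ne, by linarith, by linarith⟩
    · exact ⟨h.1.ne', by linarith, by linarith⟩
  · rintro ⟨h, h1, h2⟩
    rcases lt_or_gt_of_ne h with h | h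
    · left; constructor <;> linarith
    · right; constructor <;> linarith

lemma measurableSet_Dset (x0 r : ℝ) : MeasurableSet (Dset x0 r) :=
  measurableSet_Ioo.union measurableSet_Ioo

lemma Dset_mono (x0 : ℝ) {r r' : ℝ} (h : r ≤ r') : Dset x0 r ⊆ Dset x0 r' := by
  intro x; rw [mem_Dset, mem_Dset]; exact fun hx => ⟨hx.1, hx.2.trans_le h⟩

lemma eVar_Dset_le (x0 r : ℝ) :
    eVariationOn ((Dset x0 r).indicator (fun _ => (1:ℝ))) (Icc 0 1) ≤ 4 := by
  have h : (Dset x0 r).indicator (fun _ => (1:ℝ)) =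
      fun x => (Ioo (x0 - r) x0).indicator (fun _ => (1:ℝ)) x
        + (Ioo x0 (x0 + r)).indicator (fun _ => (1:ℝ)) x := by
    ext x
    simp only [Dset, indicator, mem_Ioo, mem_union]
    split_ifs <;> grind
  rw [h]
  refine (eVar_add_le _ _ _).trans ?_
  calc _ ≤ (2:ℝ≥0∞) + 2 := add_le_add (eVar_Ioo_le _ _) (eVar_Ioo_le _ _)
    _ = 4 := by norm_num

lemma mLeb_Dset_le (x0 r : ℝ) (hr : 0 ≤ r) : mLeb.real (Dset x0 r) ≤ 2 * r := by
  have h1 : mLeb (Dset x0 r) ≤ ENNReal.ofReal (2 * r) := by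
    calc mLeb (Dset x0 r) ≤ volume (Dset x0 r) := Measure.restrict_apply_le _ _
      _ ≤ volume (Ioo (x0 - r) x0) + volume (Ioo x0 (x0 + r)) := measure_union_le _ _
      _ = ENNReal.ofReal (2 * r) := by
        rw [Real.volume_Ioo, Real.volume_Ioo, ← ENNReal.ofReal_add (by linarith) (by linarith)]
        congr 1; ring
  exact ENNReal.toReal_le_of_le_ofReal (by linarith) h1

lemma BVnorm_nonneg (f : ℝ → ℝ) : 0 ≤ BVnorm f :=
  add_nonneg (integral_nonneg fun _ => abs_nonneg _) ENNReal.toReal_nonneg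

lemma var_nonneg (f : ℝ → ℝ) : 0 ≤ var f := ENNReal.toReal_nonneg

lemma IsBV.sup_le {f : ℝ → ℝ} (hf : IsBV f) {x : ℝ} (hx : x ∈ Icc (0:ℝ) 1) :
    |f x| ≤ BVnorm f := by
  have h1 : ∀ᵐ y ∂mLeb, |f x| - var f ≤ |f y| := by
    filter_upwards [mLeb_ae_mem] with y hy
    have := hf.2.dist_le hx hy
    rw [Real.dist_eq] at this
    have h2 := abs_sub_abs_le_abs_sub (f x) (f y)
    unfold var
    linarith
  have h2 := integral_mono_ae (integrable_const _) hf.1.abs h1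
  simp only [integral_const, probReal_univ, smul_eq_mul, one_mul] at h2
  unfold BVnorm
  linarith

lemma IsBV.one : IsBV (fun _ => (1:ℝ)) :=
  ⟨integrable_const _, by simp [BoundedVariationOn, eVar_const]⟩

lemma BVnorm_one : BVnorm (fun _ => (1:ℝ)) = 1 := by
  simp [BVnorm, var, eVar_const]

lemma IsBV.sub {f g : ℝ → ℝ} (hf : IsBV f) (hg : IsBV g) : IsBV (fun x => f x - g x) :=
  ⟨hf.1.sub hg.1, ne_top_of_le_ne_top (ENNReal.add_ne_top.2 ⟨hf.2, hg.2⟩) (eVar_sub_le _ _ _)⟩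

lemma BVnorm_sub_le {f g : ℝ → ℝ} (hf : IsBV f) (hg : IsBV g) :
    BVnorm (fun x => f x - g x) ≤ BVnorm f + BVnorm g := by
  unfold BVnorm var
  have h1 : ∫ x, |f x - g x| ∂mLeb ≤ ∫ x, |f x| ∂mLeb + ∫ x, |g x| ∂mLeb := by
    rw [← integral_add hf.1.abs hg.1.abs]
    exact integral_mono (hf.1.sub hg.1).abs (hf.1.abs.add hg.1.abs) fun x => abs_sub _ _
  have h2 := ENNReal.toReal_mono (ENNReal.add_ne_top.2 ⟨hf.2, hg.2⟩) (eVar_sub_le f g (Icc 0 1))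
  rw [ENNReal.toReal_add hf.2 hg.2] at h2
  linarith

lemma IsBV.indicator_sub_mul {f : ℝ → ℝ} (hf : IsBV f) {A : Set ℝ} (hA : MeasurableSet A)
    {V : ℝ} (hV0 : 0 ≤ V)
    (hV : eVariationOn (A.indicator (fun _ => (1:ℝ))) (Icc 0 1) ≤ ENNReal.ofReal V)
    {c : ℝ} (hc : |c| ≤ 1) :
    IsBV (fun x => (A.indicator (fun _ => (1:ℝ)) x - c) * f x) ∧
    BVnorm (fun x => (A.indicator (fun _ => (1:ℝ)) x - c) * f x) ≤ (2 + V) * BVnorm f := by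
  have hb : ∀ x, |A.indicator (fun _ => (1:ℝ)) x - c| ≤ 2 := by
    intro x
    have : |A.indicator (fun _ => (1:ℝ)) x| ≤ 1 := by
      simp only [indicator]; split_ifs <;> simp
    linarith [abs_sub (A.indicator (fun _ => (1:ℝ)) x) c]
  have hm : Measurable (fun x => A.indicator (fun _ => (1:ℝ)) x - c) :=
    (measurable_const.indicator hA).sub_const c
  have hint : Integrable (fun x => (A.indicator (fun _ => (1:ℝ)) x - c) * f x) mLeb := by
    refine hf.1.bdd_mul (c := 2) hm.aestronglyMeasurable ?_
    exact ae_of_all _ fun x => by simpa using hb x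
  have hvar1 : eVariationOn (fun x => A.indicator (fun _ => (1:ℝ)) x - c) (Icc 0 1)
      ≤ ENNReal.ofReal V := by
    refine (eVar_sub_le _ _ _).trans ?_
    simpa [eVar_const] using hV
  have hvar : eVariationOn (fun x => (A.indicator (fun _ => (1:ℝ)) x - c) * f x) (Icc 0 1)
      ≤ ENNReal.ofReal (2 * var f + BVnorm f * V) := by
    have := eVariationOn_fun_mul_le (f := fun x => A.indicator (fun _ => (1:ℝ)) x - c) (g := f)
      (s := Icc (0:ℝ) 1) (C := 2) (D := ENNReal.ofReal (BVnorm f)) (fun x _ => by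
        rw [Real.enorm_eq_ofReal_abs]
        exact (ENNReal.ofReal_le_ofReal (hb x)).trans (by simp)) (fun x hx => by
        rw [Real.enorm_eq_ofReal_abs]
        exact (ENNReal.ofReal_le_ofReal (hf.sup_le hx)))
    refine this.trans ?_
    rw [ENNReal.ofReal_add (by linarith [var_nonneg f]) (mul_nonneg (BVnorm_nonneg f) hV0),
      ENNReal.ofReal_mul (BVnorm_nonneg f), ENNReal.ofReal_mul (by norm_num)]
    gcongr
    · simp
    · rw [var, ENNReal.ofReal_toReal hf.2]
  refine ⟨⟨hint, ne_top_of_le_ne_top ENNReal.ofReal_ne_top hvar⟩, ?_⟩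
  have h2 := ENNReal.toReal_le_of_le_ofReal (by
    have := var_nonneg f; have := BVnorm_nonneg f; positivity) hvar
  have h1 : ∫ x, |(A.indicator (fun _ => (1:ℝ)) x - c) * f x| ∂mLeb ≤ 2 * ∫ x, |f x| ∂mLeb := by
    rw [← integral_const_mul]
    refine integral_mono hint.abs (hf.1.abs.const_mul 2) fun x => ?_
    simp only [abs_mul]
    gcongr
    exact hb x
  calc BVnorm (fun x => (A.indicator (fun _ => (1:ℝ)) x - c) * f x)
      ≤ 2 * ∫ x, |f x| ∂mLeb + (2 * var f + BVnorm f * V) := add_le_add h1 h2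
    _ = (2 + V) * BVnorm f := by simp only [BVnorm]; ring

/-- one-sided averages converge -/
lemma avg_limit (F : ℝ → ℝ) (l a : ℝ) (I : ℝ → Set ℝ) (hI : ∀ r, 0 < r → volume (I r) = ENNReal.ofReal r)
    (hIm : ∀ r, MeasurableSet (I r))
    (s : Set ℝ) (hs : ∀ r, I r ⊆ s) (hsm : ∀ r, ∀ x ∈ I r, |x - a| < r)
    (hint : Integrable F volume)
    (hF : Tendsto F (𝓝[s] a) (𝓝 l)) :
    Tendsto (fun r => (∫ x in I r, F x) / r) (𝓝[>] 0) (𝓝 l) := by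
  rw [Metric.tendsto_nhds]
  intro ε hε
  rw [Metric.tendsto_nhdsWithin_nhds] at hF
  obtain ⟨δ, hδ, h⟩ := hF (ε/2) (by positivity)
  filter_upwards [Ioo_mem_nhdsGT hδ] with r hr
  have hfin : volume (I r) < ⊤ := by rw [hI r hr.1]; exact ENNReal.ofReal_lt_top
  have h1 : ‖∫ x in I r, (F x - l)‖ ≤ ε/2 * volume.real (I r) := by
    refine norm_setIntegral_le_of_norm_le_const hfin fun x hx => ?_
    have := h (hs r hx) (by rw [Real.dist_eq]; exact (hsm r x hx).trans hr.2)
    rw [Real.dist_eq] at this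
    exact this.le
  have hreal : volume.real (I r) = r := by
    rw [Measure.real, hI r hr.1, ENNReal.toReal_ofReal hr.1.le]
  rw [integral_sub hint.integrableOn (integrableOn_const hfin.ne), setIntegral_const, hreal,
    smul_eq_mul, Real.norm_eq_abs] at h1
  rw [Real.dist_eq]
  have : (∫ x in I r, F x) / r - l = ((∫ x in I r, F x) - r * l) / r := by
    field_simp [hr.1.ne']
  rw [this, abs_div, abs_of_pos hr.1, div_lt_iff₀ hr.1]
  nlinarith [hr.1]

lemma IsBV.avg {f : ℝ → ℝ} (hf : IsBV f) (x0 : ℝ) (hx0 : x0 ∈ Icc (0:ℝ) 1) :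
    ∃ L, Tendsto (fun r => (∫ x in Dset x0 r, f x ∂mLeb) / r) (𝓝[>] 0) (𝓝 L) := by
  set F : ℝ → ℝ := (Icc (0:ℝ) 1).indicator f with hFdef
  have hFint : Integrable F volume := by
    rw [hFdef, integrable_indicator_iff measurableSet_Icc]; exact hf.1
  have hset : ∀ S, MeasurableSet S → ∫ x in S, f x ∂mLeb = ∫ x in S, F x := by
    intro S hS
    rw [hFdef, setIntegral_indicator measurableSet_Icc, mLeb,
      Measure.restrict_restrict hS]
  have hR : ∃ l, Tendsto F (𝓝[Ioi x0] x0) (𝓝 l) := by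
    by_cases h1 : x0 < 1
    · obtain ⟨l, hl⟩ := hf.2.exists_tendsto_right x0
      refine ⟨l, ?_⟩
      have hmem : Ioo x0 1 ∈ 𝓝[>] x0 := Ioo_mem_nhdsGT h1
      have hEq : F =ᶠ[𝓝[>] x0] f := by
        filter_upwards [hmem] with x hx
        rw [hFdef, indicator_of_mem]
        exact ⟨hx0.1.trans hx.1.le, hx.2.le⟩
      refine Tendsto.congr' hEq.symm ?_
      refine hl.mono_left ?_
      refine le_inf inf_le_left ?_
      rw [le_principal_iff]
      filter_upwards [hmem] with x hx
      exact ⟨⟨hx0.1.trans hx.1.le, hx.2.le⟩, hx.1⟩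
    · refine ⟨0, ?_⟩
      refine Tendsto.congr' ?_ tendsto_const_nhds
      filter_upwards [self_mem_nhdsWithin] with x hx
      rw [hFdef, indicator_of_notMem]
      intro h; exact h1 (lt_of_lt_of_le hx h.2)
  have hL : ∃ l, Tendsto F (𝓝[Iio x0] x0) (𝓝 l) := by
    by_cases h1 : 0 < x0
    · obtain ⟨l, hl⟩ := hf.2.exists_tendsto_left x0
      refine ⟨l, ?_⟩
      have hmem : Ioo 0 x0 ∈ 𝓝[<] x0 := Ioo_mem_nhdsLT h1
      have hEq : F =ᶠ[𝓝[<] x0] f := by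
        filter_upwards [hmem] with x hx
        rw [hFdef, indicator_of_mem]
        exact ⟨hx.1.le, hx.2.le.trans hx0.2⟩
      refine Tendsto.congr' hEq.symm ?_
      refine hl.mono_left ?_
      refine le_inf inf_le_left ?_
      rw [le_principal_iff]
      filter_upwards [hmem] with x hx
      exact ⟨⟨hx.1.le, hx.2.le.trans hx0.2⟩, hx.2⟩
    · refine ⟨0, ?_⟩
      refine Tendsto.congr' ?_ tendsto_const_nhds
      filter_upwards [self_mem_nhdsWithin] with x hx
      rw [hFdef, indicator_of_notMem]
      intro h; exact h1 (lt_of_le_of_lt h.1 hx)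
  obtain ⟨l1, hl1⟩ := hR
  obtain ⟨l2, hl2⟩ := hL
  have e1 := avg_limit F l1 x0 (fun r => Ioo x0 (x0 + r)) (fun r hr => by simp [Real.volume_Ioo])
    (fun r => measurableSet_Ioo) (Ioi x0) (fun r x hx => hx.1)
    (fun r x hx => by rw [abs_lt]; constructor <;> linarith [hx.1, hx.2]) hFint hl1
  have e2 := avg_limit F l2 x0 (fun r => Ioo (x0 - r) x0) (fun r hr => by simp [Real.volume_Ioo])
    (fun r => measurableSet_Ioo) (Iio x0) (fun r x hx => hx.2)
    (fun r x hx => by rw [abs_lt]; constructor <;> linarith [hx.1, hx.2]) hFint hl2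
  refine ⟨l2 + l1, ?_⟩
  refine (e2.add e1).congr fun r => ?_
  rw [hset _ (measurableSet_Dset x0 r), Dset, setIntegral_union _ measurableSet_Ioo
    hFint.integrableOn hFint.integrableOn, add_div]
  rw [Set.disjoint_left]
  intro x hx hx'
  exact absurd hx.2 (not_lt.2 hx'.1.le)

end

noncomputable section

/-- iterated shift -/
def sh {m : ℕ} (j : ℕ) (ω : Om m) : Om m := fun i => ω (i + j)

lemma sh_zero {m : ℕ} (ω : Om m) : sh 0 ω = ω := by ext i; simp [sh]

lemma sh_sh {m : ℕ} (j l : ℕ) (ω : Om m) : sh l (sh j ω) = sh (j + l) ω := by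
  funext i; simp only [sh]; congr 1; push_cast; ring

lemma shift_sh {m : ℕ} (j : ℕ) (ω : Om m) : shift (sh j ω) = sh (j + 1) ω := by
  funext i; simp only [sh, shift]; congr 1; push_cast; ring

lemma sh_one {m : ℕ} (ω : Om m) : sh 1 ω = shift ω := by
  funext i; simp [sh, shift]

lemma randComp_add {m : ℕ} (T : Fin m → ℝ → ℝ) (ω : Om m) (j l : ℕ) (x : ℝ) :
    randComp T ω (j + l) x = randComp T (sh j ω) l (randComp T ω j x) := by
  induction l with
  | zero => rfl
  | succ l ih =>
    rw [← add_assoc]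
    simp only [randComp, ih]
    congr 1
    simp only [sh]; congr 1; push_cast; ring

lemma Pcomp_add {m : ℕ} (Pop : Fin m → (ℝ → ℝ) → ℝ → ℝ) (ω : Om m) (j l : ℕ) (f : ℝ → ℝ) :
    Pcomp Pop ω (j + l) f = Pcomp Pop (sh j ω) l (Pcomp Pop ω j f) := by
  induction l with
  | zero => rfl
  | succ l ih =>
    rw [← add_assoc]
    simp only [Pcomp, ih]
    congr 1
    simp only [sh]; congr 1; push_cast; ring

lemma randComp_congr {m : ℕ} (T : Fin m → ℝ → ℝ) (ω ω' : Om m) (n : ℕ)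
    (h : ∀ i : ℕ, i < n → ω i = ω' i) : randComp T ω n = randComp T ω' n := by
  induction n with
  | zero => rfl
  | succ n ih =>
    simp only [randComp]
    rw [ih fun i hi => h i (by omega), h n (by omega)]

lemma randComp_measurable {m : ℕ} {T : Fin m → ℝ → ℝ} (hT : ∀ i, Measurable (T i)) (ω : Om m)
    (n : ℕ) : Measurable (randComp T ω n) := by
  induction n with
  | zero => exact measurable_id
  | succ n ih => exact (hT _).comp ih

/-- the duality hypothesis -/
def Dual {m : ℕ} (T : Fin m → ℝ → ℝ) (Pop : Fin m → (ℝ → ℝ) → ℝ → ℝ) : Prop :=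
  ∀ (i : Fin m) (f : ℝ → ℝ), Integrable f mLeb →
      ∀ g : ℝ → ℝ, Measurable g → (∃ Cg : ℝ, ∀ x, |g x| ≤ Cg) →
        ∫ x, g (T i x) * f x ∂mLeb = ∫ x, g x * Pop i f x ∂mLeb

lemma L1_contr {m : ℕ} {T : Fin m → ℝ → ℝ} {Pop : Fin m → (ℝ → ℝ) → ℝ → ℝ}
    (hT : ∀ i, Measurable (T i))
    (hdual : Dual T Pop) (hPopBV : ∀ (i : Fin m) (f : ℝ → ℝ), IsBV f → IsBV (Pop i f))
    (i : Fin m) (f : ℝ → ℝ) (hf : IsBV f) :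
    ∫ x, |Pop i f x| ∂mLeb ≤ ∫ x, |f x| ∂mLeb := by
  have hP := hPopBV i f hf
  set F := hP.1.aestronglyMeasurable.mk (Pop i f) with hF
  have hFm : Measurable F := hP.1.aestronglyMeasurable.stronglyMeasurable_mk.measurable
  have hFe : Pop i f =ᵐ[mLeb] F := hP.1.aestronglyMeasurable.ae_eq_mk
  set g : ℝ → ℝ := fun x => if 0 ≤ F x then 1 else -1 with hg
  have hgm : Measurable g := Measurable.ite (measurableSet_le measurable_const hFm)
    measurable_const measurable_const
  have hgb : ∀ x, |g x| ≤ 1 := by intro x; simp only [hg]; split_ifs <;> simp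
  have h := hdual i f hf.1 g hgm ⟨1, hgb⟩
  have e : ∫ x, |Pop i f x| ∂mLeb = ∫ x, g x * Pop i f x ∂mLeb := by
    apply integral_congr_ae
    filter_upwards [hFe] with x hx
    rw [hx]
    simp only [hg]
    split_ifs with h
    · rw [abs_of_nonneg h, one_mul]
    · rw [abs_of_neg (not_le.1 h)]; ring
  rw [e, ← h]
  refine (le_abs_self _).trans ?_
  rw [← Real.norm_eq_abs]
  refine norm_integral_le_of_norm_le hf.1.abs (ae_of_all _ fun x => ?_)
  rw [Real.norm_eq_abs, abs_mul]
  exact mul_le_of_le_one_left (abs_nonneg _) (hgb _)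

lemma Pcomp_BV {m : ℕ} {Pop : Fin m → (ℝ → ℝ) → ℝ → ℝ}
    (hPopBV : ∀ (i : Fin m) (f : ℝ → ℝ), IsBV f → IsBV (Pop i f))
    (ω : Om m) (n : ℕ) (f : ℝ → ℝ) (hf : IsBV f) : IsBV (Pcomp Pop ω n f) := by
  induction n with
  | zero => exact hf
  | succ n ih => exact hPopBV _ _ ih

lemma Pcomp_L1 {m : ℕ} {T : Fin m → ℝ → ℝ} {Pop : Fin m → (ℝ → ℝ) → ℝ → ℝ}
    (hT : ∀ i, Measurable (T i))
    (hdual : Dual T Pop) (hPopBV : ∀ (i : Fin m) (f : ℝ → ℝ), IsBV f → IsBV (Pop i f))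
    (ω : Om m) (n : ℕ) (f : ℝ → ℝ) (hf : IsBV f) :
    ∫ x, |Pcomp Pop ω n f x| ∂mLeb ≤ ∫ x, |f x| ∂mLeb := by
  induction n with
  | zero => exact le_rfl
  | succ n ih => exact (L1_contr hT hdual hPopBV _ _ (Pcomp_BV hPopBV ω n f hf)).trans ih

lemma Pcomp_dual {m : ℕ} {T : Fin m → ℝ → ℝ} {Pop : Fin m → (ℝ → ℝ) → ℝ → ℝ}
    (hT : ∀ i, Measurable (T i))
    (hdual : Dual T Pop) (hPopBV : ∀ (i : Fin m) (f : ℝ → ℝ), IsBV f → IsBV (Pop i f))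
    (ω : Om m) (n : ℕ) (f : ℝ → ℝ) (hf : IsBV f)
    (g : ℝ → ℝ) (hg : Measurable g) (hgb : ∃ C, ∀ x, |g x| ≤ C) :
    ∫ x, g (randComp T ω n x) * f x ∂mLeb = ∫ x, g x * Pcomp Pop ω n f x ∂mLeb := by
  induction n generalizing g with
  | zero => rfl
  | succ n ih =>
    simp only [randComp, Pcomp]
    rw [← hdual _ _ (Pcomp_BV hPopBV ω n f hf).1 g hg hgb]
    obtain ⟨C, hC⟩ := hgb
    exact ih (fun x => g (T (ω n) x)) (hg.comp (hT _)) ⟨C, fun x => hC _⟩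

lemma exists_K {m : ℕ} {T : Fin m → ℝ → ℝ} {Pop : Fin m → (ℝ → ℝ) → ℝ → ℝ}
    (hT : ∀ i, Measurable (T i))
    (hdual : Dual T Pop) (hPopBV : ∀ (i : Fin m) (f : ℝ → ℝ), IsBV f → IsBV (Pop i f))
    (r : ℕ) (hr : 1 ≤ r) (M D : ℝ) (hM : 0 < M) (hD : 0 < D)
    (ρ : ℝ) (hρ : ρ ∈ Set.Ioo (0 : ℝ) 1)
    (hLY1 : ∀ (ω : Om m) (f : ℝ → ℝ), IsBV f → BVnorm (Pop (ω 0) f) ≤ M * BVnorm f)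
    (hLY2 : ∀ (ω : Om m) (f : ℝ → ℝ), IsBV f →
      var (Pcomp Pop ω r f) ≤ ρ * var f + D * ∫ x, |f x| ∂mLeb) :
    ∃ K : ℝ, 1 ≤ K ∧ ∀ (ω : Om m) (n : ℕ) (f : ℝ → ℝ), IsBV f →
      BVnorm (Pcomp Pop ω n f) ≤ K * BVnorm f := by
  set M' := max 1 M with hM'
  have hM1 : 1 ≤ M' := le_max_left _ _
  have h1ρ : 0 < 1 - ρ := by linarith [hρ.2]
  set D' := D / (1 - ρ) with hD'
  have hD'0 : 0 < D' := div_pos hD h1ρ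
  have hD'eq : ρ * D' + D = D' := by rw [hD']; field_simp; ring
  have hstep : ∀ (ω : Om m) (s : ℕ) (f : ℝ → ℝ), IsBV f →
      BVnorm (Pcomp Pop ω s f) ≤ M' ^ s * BVnorm f := by
    intro ω s f hf
    induction s with
    | zero => simp [Pcomp]
    | succ s ih =>
      have h := hLY1 (sh s ω) (Pcomp Pop ω s f) (Pcomp_BV hPopBV ω s f hf)
      have e : sh s ω 0 = ω s := by simp [sh]
      rw [e] at h
      simp only [Pcomp]
      calc _ ≤ M * BVnorm (Pcomp Pop ω s f) := h
        _ ≤ M' * (M' ^ s * BVnorm f) := mul_le_mul (le_max_right _ _) ih (BVnorm_nonneg _) (by linarith)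
        _ = _ := by ring
  have hk : ∀ (ω : Om m) (k : ℕ) (f : ℝ → ℝ), IsBV f →
      var (Pcomp Pop ω (k * r) f) ≤ var f + D' * ∫ x, |f x| ∂mLeb := by
    intro ω k f hf
    have hL0 : 0 ≤ ∫ x, |f x| ∂mLeb := integral_nonneg fun _ => abs_nonneg _
    induction k with
    | zero => simp only [zero_mul, Pcomp]; nlinarith
    | succ k ih =>
      rw [Nat.succ_mul, Pcomp_add]
      have h := hLY2 (sh (k * r) ω) _ (Pcomp_BV hPopBV ω (k * r) f hf)
      have h2 := Pcomp_L1 hT hdual hPopBV ω (k * r) f hf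
      have h3 : ρ * var (Pcomp Pop ω (k * r) f) ≤ ρ * (var f + D' * ∫ x, |f x| ∂mLeb) :=
        mul_le_mul_of_nonneg_left ih hρ.1.le
      have h4 : D * ∫ x, |Pcomp Pop ω (k * r) f x| ∂mLeb ≤ D * ∫ x, |f x| ∂mLeb :=
        mul_le_mul_of_nonneg_left h2 hD.le
      have h5 : ρ * var f ≤ var f := by nlinarith [var_nonneg f, hρ.2]
      have h6 : (ρ * D' + D) * ∫ x, |f x| ∂mLeb = D' * ∫ x, |f x| ∂mLeb := by rw [hD'eq]
      linarith
  refine ⟨M' ^ r * (1 + D'), ?_, ?_⟩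
  · have := one_le_pow₀ hM1 (n := r); nlinarith
  intro ω n f hf
  have hn : n = (n / r) * r + n % r := by rw [mul_comm]; exact (Nat.div_add_mod n r).symm
  rw [hn, Pcomp_add]
  have hL0 : 0 ≤ ∫ x, |f x| ∂mLeb := integral_nonneg fun _ => abs_nonneg _
  have hb : BVnorm (Pcomp Pop ω (n / r * r) f) ≤ (1 + D') * BVnorm f := by
    have h1 := hk ω (n / r) f hf
    have h2 := Pcomp_L1 hT hdual hPopBV ω (n / r * r) f hf
    simp only [BVnorm] at *
    nlinarith [var_nonneg f]
  calc _ ≤ M' ^ (n % r) * BVnorm (Pcomp Pop ω (n / r * r) f) :=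
        hstep _ _ _ (Pcomp_BV hPopBV _ _ _ hf)
    _ ≤ M' ^ r * ((1 + D') * BVnorm f) := by
        apply mul_le_mul _ hb (BVnorm_nonneg _) (by positivity)
        exact pow_le_pow_right₀ hM1 (Nat.mod_lt _ hr).le
    _ = _ := by ring

/-- The bundled hypotheses on the cocycle. -/
structure Sys {m : ℕ} (T : Fin m → ℝ → ℝ) (Pop : Fin m → (ℝ → ℝ) → ℝ → ℝ)
    (K Cd θ : ℝ) : Prop where
  Tmeas : ∀ i, Measurable (T i)
  dual : Dual T Pop
  popBV : ∀ (i : Fin m) (f : ℝ → ℝ), IsBV f → IsBV (Pop i f)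
  hK : 1 ≤ K
  bound : ∀ (ω : Om m) (n : ℕ) (f : ℝ → ℝ), IsBV f → BVnorm (Pcomp Pop ω n f) ≤ K * BVnorm f
  hCd : 0 < Cd
  hθ0 : 0 < θ
  hθ1 : θ < 1
  dec : ∀ (n : ℕ), 1 ≤ n → ∀ (ω : Om m) (f : ℝ → ℝ), IsBV f →
      (∫ x, f x ∂mLeb) = 0 → BVnorm (Pcomp Pop ω n f) ≤ Cd * θ ^ n * BVnorm f

lemma abs_integral_mul_le {f g : ℝ → ℝ} {C : ℝ} (hf : IsBV f) (hC : BVnorm f ≤ C)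
    (hg : Integrable g mLeb) :
    |∫ x, g x * f x ∂mLeb| ≤ C * ∫ x, |g x| ∂mLeb := by
  rw [← integral_const_mul, ← Real.norm_eq_abs]
  refine norm_integral_le_of_norm_le (hg.abs.const_mul C) ?_
  filter_upwards [mLeb_ae_mem] with x hx
  rw [Real.norm_eq_abs, abs_mul, mul_comm]
  exact mul_le_mul_of_nonneg_right ((hf.sup_le hx).trans hC) (abs_nonneg _)

lemma integrable_of_bdd {g : ℝ → ℝ} (hg : Measurable g) (hgb : ∃ C, ∀ x, |g x| ≤ C) :
    Integrable g mLeb := by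
  obtain ⟨C, hC⟩ := hgb
  exact Integrable.of_bound hg.aestronglyMeasurable C (ae_of_all _ hC)

lemma Sys.DC {m : ℕ} {T : Fin m → ℝ → ℝ} {Pop : Fin m → (ℝ → ℝ) → ℝ → ℝ}
    {K Cd θ : ℝ} (S : Sys T Pop K Cd θ) (ω : Om m) (l : ℕ) (hl : 1 ≤ l) (f : ℝ → ℝ) (hf : IsBV f)
    (hf0 : ∫ x, f x ∂mLeb = 0) {B : ℝ} (hB : BVnorm f ≤ B)
    (g : ℝ → ℝ) (hg : Measurable g) (hgb : ∃ C, ∀ x, |g x| ≤ C) :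
    |∫ x, g (randComp T ω l x) * f x ∂mLeb| ≤ Cd * θ ^ l * B * ∫ x, |g x| ∂mLeb := by
  rw [Pcomp_dual S.Tmeas S.dual S.popBV ω l f hf g hg hgb]
  apply abs_integral_mul_le (Pcomp_BV S.popBV ω l f hf) _ (integrable_of_bdd hg hgb)
  refine (S.dec l hl ω f hf hf0).trans ?_
  have := S.hCd; have := S.hθ0
  gcongr

end

noncomputable section

/-- one-symbol law -/
def symLaw {m : ℕ} (p : Fin m → ℝ) : Measure (Fin m) :=
  ∑ i, ENNReal.ofReal (p i) • Measure.dirac i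

lemma symLaw_singleton {m : ℕ} (p : Fin m → ℝ) (a : Fin m) :
    symLaw p {a} = ENNReal.ofReal (p a) := by
  simp only [symLaw, Measure.coe_finsetSum, Finset.sum_apply, Measure.smul_apply, smul_eq_mul]
  rw [Finset.sum_eq_single a]
  · simp
  · intro b _ hb; simp [hb]
  · simp

/-- cylinder formula -/
def Cyl {m : ℕ} (p : Fin m → ℝ) (P : Measure (Om m)) : Prop :=
  ∀ (s : Finset ℤ) (f : ℤ → Fin m),
      P {ω | ∀ i ∈ s, ω i = f i} = ENNReal.ofReal (∏ i ∈ s, p (f i))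

lemma symLaw_prob {m : ℕ} {p : Fin m → ℝ} (hp : ∀ i, 0 < p i) (hp1 : ∑ i, p i = 1) :
    IsProbabilityMeasure (symLaw p) := by
  refine ⟨?_⟩
  simp only [symLaw, Measure.coe_finsetSum, Finset.sum_apply, Measure.smul_apply, smul_eq_mul,
    measure_univ, mul_one]
  rw [← ENNReal.ofReal_sum_of_nonneg fun i _ => (hp i).le, hp1, ENNReal.ofReal_one]

lemma Cyl.eq {m : ℕ} (hm : 1 ≤ m) {p : Fin m → ℝ} (hp : ∀ i, 0 < p i) (hp1 : ∑ i, p i = 1)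
    {P : Measure (Om m)} [IsProbabilityMeasure P] (hP : Cyl p P) :
    haveI := symLaw_prob hp hp1
    P = Measure.infinitePi (fun _ : ℤ => symLaw p) := by
  haveI := symLaw_prob hp hp1
  symm
  refine (Measure.isProjectiveLimit_infinitePi (fun _ : ℤ => symLaw p)).unique ?_
  intro s
  apply Measure.ext_of_singleton
  intro x
  rw [Measure.map_apply (by fun_prop) (measurableSet_singleton _), Measure.pi_singleton]
  classical
  set f : ℤ → Fin m := fun i => if h : i ∈ s then x ⟨i, h⟩ else ⟨0, hm⟩ with hf
  have e : (s.restrict (π := fun _ : ℤ => Fin m)) ⁻¹' {x} = {ω : Om m | ∀ i ∈ s, ω i = f i} := by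
    ext ω
    simp only [mem_preimage, mem_singleton_iff, mem_ofPred_eq, funext_iff]
    constructor
    · intro h i hi
      have := h ⟨i, hi⟩
      simp only [Finset.restrict] at this
      simp [hf, hi, this]
    · rintro h ⟨i, hi⟩
      simp only [Finset.restrict]
      rw [h i hi]; simp [hf, hi]
  rw [e, hP s f, ENNReal.ofReal_prod_of_nonneg fun i _ => (hp _).le, ← Finset.prod_coe_sort]
  refine Finset.prod_congr rfl fun i _ => ?_
  rw [symLaw_singleton]
  simp [hf]

lemma sh_measurable {m : ℕ} (j : ℕ) : Measurable (sh (m := m) j) := by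
  unfold sh
  fun_prop

lemma Cyl.map_sh {m : ℕ} {p : Fin m → ℝ}
    {P : Measure (Om m)} (hP : Cyl p P) (j : ℕ) : Cyl p (P.map (sh j)) := by
  intro s f
  classical
  rw [Measure.map_apply (sh_measurable j)]
  · have := hP (s.map (addRightEmbedding (j:ℤ))) (fun i => f (i - j))
    simp only [Finset.prod_map, addRightEmbedding_apply, add_sub_cancel_right] at this
    rw [← this]
    congr 1
    ext ω
    simp [sh]
  · have : {ω : Om m | ∀ i ∈ s, ω i = f i} = ⋂ i ∈ s, (fun ω => ω i) ⁻¹' {f i} := by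
      ext ω; simp
    rw [this]
    exact Finset.measurableSet_biInter s fun i _ => measurable_pi_apply i (measurableSet_singleton _)

lemma Cyl.mp {m : ℕ} (hm : 1 ≤ m) {p : Fin m → ℝ} (hp : ∀ i, 0 < p i) (hp1 : ∑ i, p i = 1)
    {P : Measure (Om m)} [IsProbabilityMeasure P] (hP : Cyl p P) (j : ℕ) :
    MeasurePreserving (sh (m := m) j) P P := by
  refine ⟨sh_measurable j, ?_⟩
  have : IsProbabilityMeasure (P.map (sh j)) :=
    Measure.isProbabilityMeasure_map (sh_measurable j).aemeasurable
  rw [(hP.map_sh j).eq hm hp hp1]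
  exact (hP.eq hm hp hp1).symm

/-- `g` depends on the coordinates `0, …, N-1` only. -/
def DepOn {m : ℕ} {β : Type*} (N : ℕ) (g : Om m → β) : Prop :=
  ∀ ω ω' : Om m, (∀ i : ℕ, i < N → ω i = ω' i) → g ω = g ω'

/-- canonical extension of a word -/
def extW {m : ℕ} (hm : 1 ≤ m) {N : ℕ} (w : Fin N → Fin m) : Om m :=
  fun i => if h : i.toNat < N then w ⟨i.toNat, h⟩ else ⟨0, hm⟩

lemma DepOn.eq_ext {m : ℕ} (hm : 1 ≤ m) {β : Type*} {N : ℕ} {g : Om m → β} (hg : DepOn N g)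
    (ω : Om m) : g ω = g (extW hm (fun i : Fin N => ω (i : ℕ))) := by
  apply hg
  intro i hi
  simp [extW, hi]

lemma DepOn.measurable {m : ℕ} (hm : 1 ≤ m) {N : ℕ} {g : Om m → ℝ} (hg : DepOn N g) :
    Measurable g := by
  have : g = (fun w : Fin N → Fin m => g (extW hm w)) ∘ (fun ω i => ω ((i : ℕ) : ℤ)) := by
    ext ω; exact hg.eq_ext hm ω
  rw [this]
  exact (measurable_of_countable _).comp (by fun_prop)

lemma DepOn.bounded {m : ℕ} (hm : 1 ≤ m) {N : ℕ} {g : Om m → ℝ} (hg : DepOn N g) :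
    ∃ C, 0 ≤ C ∧ ∀ ω, |g ω| ≤ C := by
  refine ⟨∑ w : Fin N → Fin m, |g (extW hm w)|, Finset.sum_nonneg fun _ _ => abs_nonneg _,
    fun ω => ?_⟩
  rw [hg.eq_ext hm ω]
  exact Finset.single_le_sum (f := fun w => |g (extW hm w)|) (fun w _ => abs_nonneg _)
    (Finset.mem_univ _)

lemma avg_blocks (N : ℕ) (hN : 1 ≤ N) (x : ℕ → ℝ) (C E : ℝ) (hC0 : 0 ≤ C) (hC : ∀ j, |x j| ≤ C)
    (h : ∀ r < N, Tendsto (fun k : ℕ => (∑ i ∈ Finset.range k, x (i * N + r)) / k) atTop (𝓝 E)) :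
    Tendsto (fun n : ℕ => (∑ j ∈ Finset.range n, x j) / n) atTop (𝓝 E) := by
  have hNr : (0:ℝ) < N := by exact_mod_cast hN
  have hblk : ∀ k, ∑ j ∈ Finset.range (k * N), x j
      = ∑ r ∈ Finset.range N, ∑ i ∈ Finset.range k, x (i * N + r) := by
    intro k
    induction k with
    | zero => simp
    | succ k ih =>
      rw [Nat.succ_mul, Finset.sum_range_add, ih, ← Finset.sum_add_distrib]
      exact Finset.sum_congr rfl fun r _ => by rw [Finset.sum_range_succ]
  have h1 : Tendsto (fun k : ℕ => (∑ j ∈ Finset.range (k * N), x j) / k) atTop (𝓝 (N * E)) := by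
    have : Tendsto (fun k : ℕ => ∑ r ∈ Finset.range N,
        (∑ i ∈ Finset.range k, x (i * N + r)) / (k:ℝ)) atTop
        (𝓝 (∑ r ∈ Finset.range N, E)) :=
      tendsto_finsetSum _ fun r hr => h r (Finset.mem_range.1 hr)
    simp only [Finset.sum_const, Finset.card_range, nsmul_eq_mul] at this
    refine this.congr fun k => ?_
    rw [hblk, Finset.sum_div]
  have hdiv : Tendsto (fun n : ℕ => n / N) atTop atTop :=
    Nat.tendsto_div_const_atTop (by omega)
  have h2 := h1.comp hdiv
  have h3 : Tendsto (fun n : ℕ => ((n / N : ℕ) : ℝ) / n) atTop (𝓝 (1 / N)) := by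
    have hlow : Tendsto (fun n : ℕ => 1 / (N:ℝ) - 1 / n) atTop (𝓝 (1 / N)) := by
      simpa using (tendsto_const_nhds (x := 1 / (N:ℝ))).sub tendsto_one_div_atTop_nhds_zero_nat
    refine tendsto_of_tendsto_of_tendsto_of_le_of_le' hlow tendsto_const_nhds ?_ ?_
    · filter_upwards [eventually_gt_atTop 0] with n hn
      have hnr : (0:ℝ) < n := by exact_mod_cast hn
      have : (n:ℝ) < N * ((n / N : ℕ) : ℝ) + N := by
        have := Nat.lt_mul_div_succ n (show 0 < N by omega)
        have h' : n < N * (n / N) + N := by rw [mul_add] at this; simpa using this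
        exact_mod_cast h'
      rw [le_div_iff₀ hnr, sub_mul, one_div, one_div, inv_mul_cancel₀ hnr.ne', inv_mul_eq_div,
        sub_le_iff_le_add, div_le_iff₀ hNr]
      nlinarith
    · filter_upwards [eventually_gt_atTop 0] with n hn
      have hnr : (0:ℝ) < n := by exact_mod_cast hn
      rw [div_le_div_iff₀ hnr hNr]
      have : n / N * N ≤ n := Nat.div_mul_le_self n N
      have : ((n / N : ℕ) : ℝ) * N ≤ n := by exact_mod_cast this
      linarith
  have h4 := h2.mul h3
  have e : (N:ℝ) * E * (1 / N) = E := by field_simp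
  rw [e] at h4
  have h5 : Tendsto (fun n : ℕ => (N * C) / (n:ℝ)) atTop (𝓝 0) :=
    tendsto_const_nhds.div_atTop tendsto_natCast_atTop_atTop
  rw [← tendsto_sub_nhds_zero_iff] at h4 ⊢
  have h6 := h4.abs.add h5
  simp only [abs_zero, add_zero] at h6
  refine squeeze_zero_norm' ?_ h6
  filter_upwards [eventually_ge_atTop N, eventually_gt_atTop 0] with n hn hn0
  have hnr : (0:ℝ) < n := by exact_mod_cast hn0
  have hkpos : 0 < n / N := Nat.div_pos hn (by omega)
  have hkr : (0:ℝ) < ((n / N : ℕ) : ℝ) := by exact_mod_cast hkpos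
  have hsplit : ∑ j ∈ Finset.range n, x j = ∑ j ∈ Finset.range (n / N * N), x j
      + ∑ j ∈ Finset.range (n % N), x (n / N * N + j) := by
    rw [← Finset.sum_range_add, mul_comm, Nat.div_add_mod]
  have hrem : |∑ j ∈ Finset.range (n % N), x (n / N * N + j)| ≤ N * C := by
    calc _ ≤ ∑ j ∈ Finset.range (n % N), |x (n / N * N + j)| := Finset.abs_sum_le_sum_abs _ _
      _ ≤ ∑ j ∈ Finset.range (n % N), C := Finset.sum_le_sum fun _ _ => hC _
      _ = (n % N : ℕ) * C := by simp
      _ ≤ N * C := by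
        gcongr
        exact (Nat.mod_lt _ (by omega)).le
  simp only [Function.comp]
  rw [Real.norm_eq_abs, hsplit]
  have e2 : (∑ j ∈ Finset.range (n / N * N), x j) / ((n / N : ℕ) : ℝ) * (((n / N : ℕ) : ℝ) / n)
      = (∑ j ∈ Finset.range (n / N * N), x j) / n := by field_simp
  rw [e2, add_div]
  have : |(∑ j ∈ Finset.range (n % N), x (n / N * N + j)) / n| ≤ N * C / n := by
    rw [abs_div, abs_of_pos hnr]; gcongr
  calc _ = |((∑ j ∈ Finset.range (n / N * N), x j) / n - E)
        + (∑ j ∈ Finset.range (n % N), x (n / N * N + j)) / n| := by congr 1; ring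
    _ ≤ _ := (abs_add_le _ _).trans (by gcongr)

open ProbabilityTheory in
lemma slln {m : ℕ} (hm : 1 ≤ m) {p : Fin m → ℝ} (hp : ∀ i, 0 < p i) (hp1 : ∑ i, p i = 1)
    {P : Measure (Om m)} [IsProbabilityMeasure P] (hP : Cyl p P)
    {N : ℕ} (hN : 1 ≤ N) {g : Om m → ℝ} (hg : DepOn N g) :
    ∀ᵐ ω ∂P, Tendsto (fun n : ℕ => (∑ j ∈ Finset.range n, g (sh j ω)) / n) atTop
      (𝓝 (∫ ω, g ω ∂P)) := by
  obtain ⟨C, hC0, hC⟩ := hg.bounded hm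
  have hgm := hg.measurable hm
  have hgint : Integrable g P := Integrable.of_bound hgm.aestronglyMeasurable C (ae_of_all _ hC)
  have hindep : iIndepFun (fun (i : ℤ) (ω : Om m) => ω i) P := by
    haveI := symLaw_prob hp hp1
    rw [hP.eq hm hp hp1]
    exact iIndepFun_infinitePi (P := fun _ : ℤ => symLaw p) (X := fun _ x => x)
      (fun _ => measurable_id)
  have key : ∀ r < N, ∀ᵐ ω ∂P, Tendsto (fun k : ℕ =>
      (∑ i ∈ Finset.range k, g (sh (i * N + r) ω)) / k) atTop (𝓝 (∫ ω, g ω ∂P)) := by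
    intro r hr
    have hid : ∀ a, IdentDistrib (fun ω => g (sh a ω)) g P P := by
      intro a
      refine ⟨(hgm.comp (sh_measurable a)).aemeasurable, hgm.aemeasurable, ?_⟩
      have h1 := (hP.mp hm hp hp1 a).map_eq
      conv_rhs => rw [← h1]
      rw [Measure.map_map hgm (sh_measurable a)]
      rfl
    have hmean : ∫ ω, g (sh (0 * N + r) ω) ∂P = ∫ ω, g ω ∂P := (hid _).integral_eq
    rw [← hmean]
    refine strong_law_ae_real (fun i ω => g (sh (i * N + r) ω)) ?_ ?_ ?_
    · exact (hid _).integrable_iff.2 hgint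
    · intro a b hab
      classical
      set S : ℕ → Finset ℤ := fun k => Finset.Ico ((k * N + r : ℕ) : ℤ) ((k * N + r : ℕ) + N : ℤ)
        with hS
      have hdisj : Disjoint (S a) (S b) := by
        rw [Finset.disjoint_left]
        intro i hi hi'
        simp only [hS, Finset.mem_Ico] at hi hi'
        apply hab
        push_cast at hi hi'
        by_contra hne
        rcases lt_or_gt_of_ne hne with h | h
        · have : (a:ℤ) + 1 ≤ b := by exact_mod_cast h
          nlinarith
        · have : (b:ℤ) + 1 ≤ a := by exact_mod_cast h
          nlinarith
      have hI := hindep.indepFun_finset (S a) (S b) hdisj (fun i => measurable_pi_apply i)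
      set G : (k : ℕ) → (S k → Fin m) → ℝ := fun k y =>
        g (fun i => if h : i + ((k * N + r : ℕ) : ℤ) ∈ S k then y ⟨_, h⟩ else ⟨0, hm⟩) with hG
      have hGe : ∀ k, (fun ω => g (sh (k * N + r) ω))
          = G k ∘ (fun (ω : Om m) (i : S k) => ω i) := by
        intro k
        ext ω
        simp only [hG, Function.comp]
        apply hg
        intro i hi
        have : (i:ℤ) + ((k * N + r : ℕ) : ℤ) ∈ S k := by
          simp only [hS, Finset.mem_Ico]; constructor <;> omega
        simp only [this, dif_pos, sh]
      show IndepFun (fun ω => g (sh (a * N + r) ω)) (fun ω => g (sh (b * N + r) ω)) P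
      rw [hGe a, hGe b]
      exact hI.comp (measurable_of_countable _) (measurable_of_countable _)
    · intro i
      exact (hid _).trans (hid _).symm
  have key' : ∀ᵐ ω ∂P, ∀ r : ℕ, r < N → Tendsto (fun k : ℕ =>
      (∑ i ∈ Finset.range k, g (sh (i * N + r) ω)) / k) atTop (𝓝 (∫ ω, g ω ∂P)) := by
    rw [ae_all_iff]; intro r
    by_cases hr : r < N
    · filter_upwards [key r hr] with ω h _ using h
    · exact ae_of_all _ fun ω h => absurd h hr
  filter_upwards [key'] with ω hω
  exact avg_blocks N hN (fun j => g (sh j ω)) C _ hC0 (fun j => hC _) hω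

end

noncomputable section

/-- indicator with value one -/
abbrev ind (A : Set ℝ) : ℝ → ℝ := A.indicator (fun _ => (1:ℝ))

lemma ind_meas {A : Set ℝ} (hA : MeasurableSet A) : Measurable (ind A) :=
  measurable_const.indicator hA

lemma ind_bdd (A : Set ℝ) : ∃ C, ∀ x, |ind A x| ≤ C :=
  ⟨1, fun x => by simp only [ind, indicator]; split_ifs <;> simp⟩

lemma ind_nonneg (A : Set ℝ) (x : ℝ) : 0 ≤ ind A x := by
  simp only [ind, indicator]; split_ifs <;> simp

lemma ind_le_one (A : Set ℝ) (x : ℝ) : ind A x ≤ 1 := by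
  simp only [ind, indicator]; split_ifs <;> simp

lemma integral_abs_ind {A : Set ℝ} (hA : MeasurableSet A) :
    ∫ x, |ind A x| ∂mLeb = mLeb.real A := by
  have : ∀ x, |ind A x| = ind A x := fun x => abs_of_nonneg (ind_nonneg A x)
  simp only [this]
  exact integral_indicator_one hA

/-- hitting probability of the punctured ball at time `N` under Lebesgue measure -/
def FN {m : ℕ} (T : Fin m → ℝ → ℝ) (x0 : ℝ) (N : ℕ) (ω : Om m) (r : ℝ) : ℝ :=
  ∫ x, ind (Dset x0 r) (randComp T ω N x) ∂mLeb

/-- its small-scale density -/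
def LN {m : ℕ} (T : Fin m → ℝ → ℝ) (x0 : ℝ) (N : ℕ) (ω : Om m) : ℝ :=
  limUnder (𝓝[>] (0:ℝ)) (fun r => FN T x0 N ω r / r)

lemma FN_dep {m : ℕ} (T : Fin m → ℝ → ℝ) (x0 : ℝ) (N : ℕ) :
    DepOn N (fun ω => FN T x0 N ω) := by
  intro ω ω' h
  funext r
  simp only [FN, randComp_congr T ω ω' N h]

lemma FN_dep' {m : ℕ} (T : Fin m → ℝ → ℝ) (x0 : ℝ) (N : ℕ) (r : ℝ) :
    DepOn N (fun ω => FN T x0 N ω r) := fun ω ω' h => congrFun (FN_dep T x0 N ω ω' h) r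

lemma LN_dep {m : ℕ} (T : Fin m → ℝ → ℝ) (x0 : ℝ) (N : ℕ) :
    DepOn N (fun ω => LN T x0 N ω) := by
  intro ω ω' h
  simp only [LN]
  rw [show FN T x0 N ω = FN T x0 N ω' from FN_dep T x0 N ω ω' h]

section
variable {m : ℕ} {T : Fin m → ℝ → ℝ} {Pop : Fin m → (ℝ → ℝ) → ℝ → ℝ} {K Cd θ : ℝ}

lemma FN_eq (S : Sys T Pop K Cd θ) (x0 : ℝ) (N : ℕ) (ω : Om m) (r : ℝ) :
    FN T x0 N ω r = ∫ x in Dset x0 r, Pcomp Pop ω N (fun _ => 1) x ∂mLeb := by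
  have := Pcomp_dual S.Tmeas S.dual S.popBV ω N (fun _ => 1) IsBV.one (ind (Dset x0 r))
    (ind_meas (measurableSet_Dset x0 r)) (ind_bdd _)
  simp only [mul_one] at this
  rw [FN, this, ← integral_indicator (measurableSet_Dset x0 r)]
  congr 1
  ext x
  simp only [ind, indicator]; split_ifs <;> simp

lemma LN_lim (S : Sys T Pop K Cd θ) (x0 : ℝ) (hx0 : x0 ∈ Icc (0:ℝ) 1) (N : ℕ) (ω : Om m) :
    Tendsto (fun r => FN T x0 N ω r / r) (𝓝[>] (0:ℝ)) (𝓝 (LN T x0 N ω)) := by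
  apply tendsto_nhds_limUnder
  obtain ⟨L, hL⟩ := (Pcomp_BV S.popBV ω N (fun _ => 1) IsBV.one).avg x0 hx0
  refine ⟨L, hL.congr fun r => ?_⟩
  rw [FN_eq S]

lemma FN_unif (hm : 1 ≤ m) (S : Sys T Pop K Cd θ) (x0 : ℝ) (hx0 : x0 ∈ Icc (0:ℝ) 1) (N : ℕ)
    {ε : ℝ} (hε : 0 < ε) :
    ∀ᶠ r in 𝓝[>] (0:ℝ), ∀ ω : Om m, |FN T x0 N ω r - r * LN T x0 N ω| ≤ ε * r := by
  have h1 : ∀ᶠ r in 𝓝[>] (0:ℝ), ∀ w : Fin N → Fin m,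
      |FN T x0 N (extW hm w) r / r - LN T x0 N (extW hm w)| < ε := by
    rw [eventually_all]
    intro w
    exact (Metric.tendsto_nhds.1 (LN_lim S x0 hx0 N (extW hm w)) ε hε)
  filter_upwards [h1, self_mem_nhdsWithin] with r hr hr0 ω
  have hr0' : (0:ℝ) < r := hr0
  rw [(FN_dep' T x0 N r).eq_ext hm ω, (LN_dep T x0 N).eq_ext hm ω]
  have h2 := hr (fun i : Fin N => ω (i : ℕ))
  have e : FN T x0 N (extW hm (fun i : Fin N => ω (i : ℕ))) r
      - r * LN T x0 N (extW hm (fun i : Fin N => ω (i : ℕ)))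
      = r * (FN T x0 N (extW hm (fun i : Fin N => ω (i : ℕ))) r / r
        - LN T x0 N (extW hm (fun i : Fin N => ω (i : ℕ)))) := by
    field_simp
  rw [e, abs_mul, abs_of_pos hr0', mul_comm]
  exact mul_le_mul_of_nonneg_right h2.le hr0'.le

/-- Comparison of two densities after `N` steps. -/
lemma compare (S : Sys T Pop K Cd θ) (ω : Om m) (N : ℕ) (hN : 1 ≤ N) (f : ℝ → ℝ) (hf : IsBV f)
    (hf1 : ∫ x, f x ∂mLeb = 1) {B : ℝ} (hB : BVnorm f ≤ B) (x0 r : ℝ) (hr : 0 ≤ r) :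
    |∫ x, ind (Dset x0 r) (randComp T ω N x) * f x ∂mLeb - FN T x0 N ω r|
      ≤ Cd * θ ^ N * (B + 1) * (2 * r) := by
  have hD := measurableSet_Dset x0 r
  have hbd : BVnorm (fun x => f x - 1) ≤ B + 1 := by
    have := BVnorm_sub_le hf IsBV.one
    rw [BVnorm_one] at this
    linarith
  have h := S.DC ω N hN (fun x => f x - 1) (hf.sub IsBV.one) (by
    rw [integral_sub hf.1 (integrable_const _), hf1]; simp) hbd (ind (Dset x0 r))
    (ind_meas hD) (ind_bdd _)
  have e : ∫ x, ind (Dset x0 r) (randComp T ω N x) * f x ∂mLeb - FN T x0 N ω r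
      = ∫ x, ind (Dset x0 r) (randComp T ω N x) * (f x - 1) ∂mLeb := by
    have hmeas : Measurable fun x => ind (Dset x0 r) (randComp T ω N x) :=
      (ind_meas hD).comp (randComp_measurable S.Tmeas ω N)
    obtain ⟨C, hC⟩ := ind_bdd (Dset x0 r)
    rw [FN, ← integral_sub]
    · congr 1; ext x; ring
    · exact hf.1.bdd_mul (c := C) hmeas.aestronglyMeasurable (ae_of_all _ fun x => hC _)
    · exact integrable_of_bdd hmeas ⟨C, fun x => hC _⟩
  rw [e]
  refine h.trans ?_
  rw [integral_abs_ind hD]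
  have hB0 : 0 ≤ B := (BVnorm_nonneg f).trans hB
  have := S.hCd; have := S.hθ0
  gcongr
  exact mLeb_Dset_le x0 r hr

lemma integral_Pcomp (S : Sys T Pop K Cd θ) (ω : Om m) (j : ℕ) (f : ℝ → ℝ) (hf : IsBV f) :
    ∫ x, Pcomp Pop ω j f x ∂mLeb = ∫ x, f x ∂mLeb := by
  have := Pcomp_dual S.Tmeas S.dual S.popBV ω j f hf (fun _ => 1) measurable_const ⟨1, by simp⟩
  simpa using this.symm

lemma push (S : Sys T Pop K Cd θ) (ω : Om m) (j l : ℕ) (f : ℝ → ℝ) (hf : IsBV f)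
    (g : ℝ → ℝ) (hg : Measurable g) (hgb : ∃ C, ∀ x, |g x| ≤ C) :
    ∫ x, g (randComp T ω (j + l) x) * f x ∂mLeb
      = ∫ x, g (randComp T (sh j ω) l x) * Pcomp Pop ω j f x ∂mLeb := by
  obtain ⟨C, hC⟩ := hgb
  rw [← Pcomp_dual S.Tmeas S.dual S.popBV ω j f hf (fun x => g (randComp T (sh j ω) l x))
    (hg.comp (randComp_measurable S.Tmeas _ _)) ⟨C, fun x => hC _⟩]
  simp only [randComp_add]

/-- hitting probability at time `j` from the density `f` -/
def hit (T : Fin m → ℝ → ℝ) (ω : Om m) (f : ℝ → ℝ) (j : ℕ) (A : Set ℝ) : ℝ :=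
  ∫ x, ind A (randComp T ω j x) * f x ∂mLeb

lemma hit_compare (S : Sys T Pop K Cd θ) (ω : Om m) (N j : ℕ) (hN : 1 ≤ N) (f : ℝ → ℝ)
    (hf : IsBV f) (hf1 : ∫ x, f x ∂mLeb = 1) (x0 r : ℝ) (hr : 0 ≤ r) :
    |hit T ω f (j + N) (Dset x0 r) - FN T x0 N (sh j ω) r|
      ≤ Cd * θ ^ N * (K * BVnorm f + 1) * (2 * r) := by
  rw [hit, push S ω j N f hf _ (ind_meas (measurableSet_Dset x0 r)) (ind_bdd _)]
  exact compare S (sh j ω) N hN _ (Pcomp_BV S.popBV ω j f hf)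
    (by rw [integral_Pcomp S ω j f hf, hf1]) (S.bound ω j f hf) x0 r hr

lemma FN_compare (S : Sys T Pop K Cd θ) (ω : Om m) (N j : ℕ) (hN : 1 ≤ N)
    (x0 r : ℝ) (hr : 0 ≤ r) :
    |FN T x0 (j + N) ω r - FN T x0 N (sh j ω) r| ≤ Cd * θ ^ N * (K + 1) * (2 * r) := by
  have := hit_compare S ω N j hN _ IsBV.one (by simp) x0 r hr
  simpa [hit, BVnorm_one, FN] using this

lemma FN_nonneg (x0 : ℝ) (N : ℕ) (ω : Om m) (r : ℝ) : 0 ≤ FN T x0 N ω r :=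
  integral_nonneg fun _ => ind_nonneg _ _

lemma FN_le_one (S : Sys T Pop K Cd θ) (x0 : ℝ) (N : ℕ) (ω : Om m) (r : ℝ) :
    FN T x0 N ω r ≤ 1 := by
  obtain ⟨C, hC⟩ := ind_bdd (Dset x0 r)
  have := integral_mono (μ := mLeb) (f := fun x => ind (Dset x0 r) (randComp T ω N x))
    (g := fun _ => 1)
    (integrable_of_bdd ((ind_meas (measurableSet_Dset x0 r)).comp
      (randComp_measurable S.Tmeas ω N)) ⟨C, fun x => hC _⟩) (integrable_const _)
    (fun x => ind_le_one _ _)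
  simpa [FN] using this

lemma mLeb_Dset_ge (x0 r : ℝ) (hx0 : x0 ∈ Icc (0:ℝ) 1) (hr : 0 < r) (hr2 : r < 1/2) :
    r ≤ mLeb.real (Dset x0 r) := by
  have key : ∀ a b : ℝ, b - a = r → 0 ≤ a → b ≤ 1 → Ioo a b ⊆ Dset x0 r →
      r ≤ mLeb.real (Dset x0 r) := by
    intro a b hab ha hb hsub
    have hs : Ioo a b ⊆ Icc (0:ℝ) 1 := fun x hx => ⟨ha.trans hx.1.le, hx.2.le.trans hb⟩
    have h1 : mLeb (Ioo a b) = ENNReal.ofReal r := by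
      rw [mLeb, Measure.restrict_apply measurableSet_Ioo,
        inter_eq_left.2 hs, Real.volume_Ioo, hab]
    have h2 : mLeb.real (Ioo a b) = r := by
      rw [Measure.real, h1, ENNReal.toReal_ofReal hr.le]
    calc r = mLeb.real (Ioo a b) := h2.symm
      _ ≤ _ := measureReal_mono hsub
  by_cases h : x0 ≤ 1/2
  · exact key x0 (x0 + r) (by ring) hx0.1 (by linarith) subset_union_right
  · exact key (x0 - r) x0 (by ring) (by linarith) hx0.2 subset_union_left

lemma FN_ge (S : Sys T Pop K Cd θ) {cmin : ℝ} (hcmin : 0 < cmin)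
    (hMin : ∀ (n : ℕ), 1 ≤ n → ∀ (ω : Om m), ∀ x ∈ Set.Icc (0 : ℝ) 1,
      cmin ≤ Pcomp Pop ω n (fun _ => 1) x)
    (x0 : ℝ) (hx0 : x0 ∈ Icc (0:ℝ) 1) (N : ℕ) (hN : 1 ≤ N) (ω : Om m) (r : ℝ) (hr : 0 < r)
    (hr2 : r < 1/2) : cmin * r ≤ FN T x0 N ω r := by
  rw [FN_eq S]
  have hP := (Pcomp_BV S.popBV ω N (fun _ => 1) IsBV.one).1
  have h := integral_mono_ae (μ := mLeb.restrict (Dset x0 r)) (f := fun _ => cmin)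
    (g := Pcomp Pop ω N (fun _ => 1)) (integrable_const _) hP.integrableOn (by
      apply ae_restrict_of_ae
      filter_upwards [mLeb_ae_mem] with x hx using hMin N hN ω x hx)
  rw [setIntegral_const, smul_eq_mul] at h
  have := mLeb_Dset_ge x0 r hx0 hr hr2
  nlinarith

lemma LN_ge (S : Sys T Pop K Cd θ) {cmin : ℝ} (hcmin : 0 < cmin)
    (hMin : ∀ (n : ℕ), 1 ≤ n → ∀ (ω : Om m), ∀ x ∈ Set.Icc (0 : ℝ) 1,
      cmin ≤ Pcomp Pop ω n (fun _ => 1) x)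
    (x0 : ℝ) (hx0 : x0 ∈ Icc (0:ℝ) 1) (N : ℕ) (hN : 1 ≤ N) (ω : Om m) :
    cmin ≤ LN T x0 N ω := by
  refine ge_of_tendsto (LN_lim S x0 hx0 N ω) ?_
  filter_upwards [Ioo_mem_nhdsGT (show (0:ℝ) < 1/2 by norm_num)] with r hr
  rw [le_div_iff₀ hr.1]
  exact FN_ge S hcmin hMin x0 hx0 N hN ω r hr.1 hr.2

end

end

noncomputable section

/-- the equivariant family -/
structure Fam {m : ℕ} (Pop : Fin m → (ℝ → ℝ) → ℝ → ℝ)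
    (h : Om m → ℝ → ℝ) (ν : Om m → Measure ℝ) : Prop where
  bv : ∀ ω, IsBV (h ω)
  equi : ∀ ω : Om m, Pop (ω 0) (h ω) =ᵐ[mLeb] h (shift ω)
  nonneg : ∀ ω, ∀ᵐ x ∂mLeb, 0 ≤ h ω x
  int1 : ∀ ω, ∫ x, h ω x ∂mLeb = 1
  nu : ∀ ω, ν ω = mLeb.withDensity (fun x => ENNReal.ofReal (h ω x))

section
variable {m : ℕ} {T : Fin m → ℝ → ℝ} {Pop : Fin m → (ℝ → ℝ) → ℝ → ℝ} {K Cd θ : ℝ}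
  {h : Om m → ℝ → ℝ} {ν : Om m → Measure ℝ}

lemma Fam.prob (F : Fam Pop h ν) (ω : Om m) : IsProbabilityMeasure (ν ω) := by
  refine ⟨?_⟩
  rw [F.nu, withDensity_apply _ MeasurableSet.univ, Measure.restrict_univ,
    ← ofReal_integral_eq_lintegral_ofReal (F.bv ω).1 (F.nonneg ω), F.int1, ENNReal.ofReal_one]

lemma Fam.real (F : Fam Pop h ν) (ω : Om m) {A : Set ℝ} (hA : MeasurableSet A) :
    (ν ω A).toReal = ∫ x, ind A x * h ω x ∂mLeb := by
  have e : (fun x => ind A x * h ω x) = A.indicator (h ω) := by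
    ext x; simp only [ind, indicator]; split_ifs <;> simp
  rw [e, integral_indicator hA, F.nu, withDensity_apply _ hA,
    integral_eq_lintegral_of_nonneg_ae (ae_restrict_of_ae (F.nonneg ω))
      (F.bv ω).1.aestronglyMeasurable.restrict]

lemma Fam.transport (S : Sys T Pop K Cd θ) (F : Fam Pop h ν) (ω : Om m) (j : ℕ)
    (g : ℝ → ℝ) (hg : Measurable g) (hgb : ∃ C, ∀ x, |g x| ≤ C) :
    ∫ x, g (randComp T ω j x) * h ω x ∂mLeb = ∫ x, g x * h (sh j ω) x ∂mLeb := by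
  induction j generalizing g with
  | zero => simp [randComp, sh_zero]
  | succ j ih =>
    obtain ⟨C, hC⟩ := hgb
    have h1 := ih (fun x => g (T (ω j) x)) (hg.comp (S.Tmeas _)) ⟨C, fun x => hC _⟩
    simp only [randComp]
    rw [h1, S.dual _ _ (F.bv _).1 g hg ⟨C, hC⟩]
    have h2 := F.equi (sh j ω)
    rw [shift_sh, show (sh j ω) 0 = ω j by simp [sh]] at h2
    apply integral_congr_ae
    filter_upwards [h2] with x hx
    rw [hx]

lemma Fam.hit_nu (S : Sys T Pop K Cd θ) (F : Fam Pop h ν) (ω : Om m) (j : ℕ)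
    {A : Set ℝ} (hA : MeasurableSet A) :
    (ν (sh j ω) A).toReal = hit T ω (h ω) j A := by
  rw [F.real _ hA, hit, F.transport S ω j _ (ind_meas hA) (ind_bdd A)]

lemma Fam.hit_eq (S : Sys T Pop K Cd θ) (F : Fam Pop h ν) (ω : Om m) (j : ℕ)
    {A : Set ℝ} (hA : MeasurableSet A) :
    hit T ω (h ω) j A = (ν ω (randComp T ω j ⁻¹' A)).toReal := by
  rw [F.real _ (randComp_measurable S.Tmeas ω j hA)]
  rfl

lemma Fam.aemeas (F : Fam Pop h ν) {P : Measure (Om m)} [IsProbabilityMeasure P]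
    {νa : Measure ℝ} (hνa : ∀ A : Set ℝ, MeasurableSet A → νa A = ∫⁻ ω, ν ω A ∂P)
    {A : Set ℝ} (hA : MeasurableSet A) : AEMeasurable (fun ω => ν ω A) P := by
  have hp := F.prob
  obtain ⟨f, hf, hfle, hfe⟩ := exists_measurable_le_lintegral_eq P (fun ω => ν ω A)
  obtain ⟨g, hg, hgle, hge⟩ := exists_measurable_le_lintegral_eq P (fun ω => ν ω Aᶜ)
  have hsum : ∀ ω, ν ω A + ν ω Aᶜ = 1 := fun ω => by
    rw [measure_add_measure_compl hA, measure_univ]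
  have h1 : ∫⁻ ω, (f ω + g ω) ∂P = 1 := by
    rw [lintegral_add_left hf, ← hfe, ← hge, ← hνa A hA, ← hνa _ hA.compl,
      measure_add_measure_compl hA, hνa _ MeasurableSet.univ]
    simp
  have h2 : (fun ω => f ω + g ω) =ᵐ[P] fun _ => 1 := by
    refine ae_eq_of_ae_le_of_lintegral_le (ae_of_all _ fun ω => ?_) (by rw [h1]; simp)
      aemeasurable_const (by simp [h1])
    rw [← hsum ω]
    exact add_le_add (hfle ω) (hgle ω)
  refine ⟨f, hf, ?_⟩
  filter_upwards [h2] with ω hω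
  apply le_antisymm _ (hfle ω)
  have hfin : g ω ≠ ∞ := ne_top_of_le_ne_top (measure_ne_top (ν ω) _) (hgle ω)
  have : ν ω A + g ω ≤ f ω + g ω := by
    rw [hω, ← hsum ω]
    exact add_le_add le_rfl (hgle ω)
  exact (ENNReal.add_le_add_iff_right hfin).1 this

lemma Fam.annealed (F : Fam Pop h ν) {P : Measure (Om m)} [IsProbabilityMeasure P]
    {νa : Measure ℝ} (hνa : ∀ A : Set ℝ, MeasurableSet A → νa A = ∫⁻ ω, ν ω A ∂P)
    {A : Set ℝ} (hA : MeasurableSet A) : (νa A).toReal = ∫ ω, (ν ω A).toReal ∂P := by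
  have hp := F.prob
  rw [hνa A hA, integral_toReal (F.aemeas hνa hA) (ae_of_all _ fun ω => measure_lt_top _ _)]

lemma Fam.annealed_hit (S : Sys T Pop K Cd θ) (F : Fam Pop h ν) (hm : 1 ≤ m) {p : Fin m → ℝ}
    (hp : ∀ i, 0 < p i) (hp1 : ∑ i, p i = 1)
    {P : Measure (Om m)} [IsProbabilityMeasure P] (hP : Cyl p P)
    {νa : Measure ℝ} (hνa : ∀ A : Set ℝ, MeasurableSet A → νa A = ∫⁻ ω, ν ω A ∂P)
    {A : Set ℝ} (hA : MeasurableSet A) (j : ℕ) :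
    AEStronglyMeasurable (fun ω => hit T ω (h ω) j A) P ∧
    (νa A).toReal = ∫ ω, hit T ω (h ω) j A ∂P := by
  have mp := hP.mp hm hp hp1 j
  have h0 : AEStronglyMeasurable (fun ω => (ν ω A).toReal) P :=
    (F.aemeas hνa hA).ennreal_toReal.aestronglyMeasurable
  simp only [← F.hit_nu S _ j hA]
  refine ⟨h0.comp_measurePreserving mp, ?_⟩
  rw [F.annealed hνa hA]
  conv_lhs => rw [← mp.map_eq]
  rw [integral_map mp.aemeasurable (by rw [mp.map_eq]; exact h0)]

lemma nua_FN (S : Sys T Pop K Cd θ) (F : Fam Pop h ν) (hm : 1 ≤ m) {p : Fin m → ℝ}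
    (hp : ∀ i, 0 < p i) (hp1 : ∑ i, p i = 1)
    {P : Measure (Om m)} [IsProbabilityMeasure P] (hP : Cyl p P)
    {νa : Measure ℝ} (hνa : ∀ A : Set ℝ, MeasurableSet A → νa A = ∫⁻ ω, ν ω A ∂P)
    (x0 : ℝ) (N : ℕ) (hN : 1 ≤ N) (r : ℝ) (hr : 0 ≤ r) :
    |(νa (Dset x0 r)).toReal - ∫ ω, FN T x0 N ω r ∂P| ≤ Cd * θ ^ N * (K + 1) * (2 * r) := by
  have hD := measurableSet_Dset x0 r
  have hpr := F.prob
  have hFNm : ∀ j, Integrable (fun ω => FN T x0 j ω r) P := fun j =>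
    Integrable.of_bound ((FN_dep' T x0 j r).measurable hm).aestronglyMeasurable 1
      (ae_of_all _ fun ω => by
        rw [Real.norm_eq_abs, abs_of_nonneg (FN_nonneg x0 j ω r)]; exact FN_le_one S x0 j ω r)
  have hhit : ∀ j, Integrable (fun ω => hit T ω (h ω) j (Dset x0 r)) P := fun j =>
    Integrable.of_bound (F.annealed_hit S hm hp hp1 hP hνa hD j).1 1
      (ae_of_all _ fun ω => by
        rw [← F.hit_nu S _ j hD, Real.norm_eq_abs, abs_of_nonneg ENNReal.toReal_nonneg]
        exact measureReal_le_one)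
  -- limit
  have hlim : Tendsto (fun j : ℕ => ∫ ω, FN T x0 j ω r ∂P) atTop
      (𝓝 (νa (Dset x0 r)).toReal) := by
    have h1 : Tendsto (fun j : ℕ => ∫ ω, (hit T ω (h ω) j (Dset x0 r) - FN T x0 j ω r) ∂P) atTop
        (𝓝 (∫ ω, (0:ℝ) ∂P)) := by
      refine tendsto_integral_of_dominated_convergence (fun _ => 2)
        (fun j => ((hhit j).sub (hFNm j)).aestronglyMeasurable) (integrable_const _)
        (fun j => ae_of_all _ fun ω => ?_) (ae_of_all _ fun ω => ?_)
      · have a1 : 0 ≤ hit T ω (h ω) j (Dset x0 r) := by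
          rw [← F.hit_nu S _ j hD]; exact ENNReal.toReal_nonneg
        have a2 : hit T ω (h ω) j (Dset x0 r) ≤ 1 := by
          rw [← F.hit_nu S _ j hD]; exact measureReal_le_one
        have a3 := FN_nonneg (T := T) x0 j ω r
        have a4 := FN_le_one S x0 j ω r
        rw [Real.norm_eq_abs, abs_le]; constructor <;> linarith
      · have hz : Tendsto (fun j : ℕ => Cd * θ ^ j * (K * BVnorm (h ω) + 1) * (2 * r)) atTop
            (𝓝 0) := by
          have := tendsto_pow_atTop_nhds_zero_of_lt_one S.hθ0.le S.hθ1
          simpa using ((this.const_mul Cd).mul_const (K * BVnorm (h ω) + 1)).mul_const (2 * r)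
        refine squeeze_zero_norm' ?_ hz
        filter_upwards [eventually_ge_atTop 1] with j hj
        have := hit_compare S ω j 0 hj (h ω) (F.bv ω) (F.int1 ω) x0 r hr
        rwa [zero_add, sh_zero] at this
    have h2 := (tendsto_const_nhds (x := (νa (Dset x0 r)).toReal)).sub h1
    simp only [integral_zero, sub_zero] at h2
    refine h2.congr fun j => ?_
    rw [integral_sub (hhit j) (hFNm j), ← (F.annealed_hit S hm hp hp1 hP hνa hD j).2]
    ring
  have hlim' : Tendsto (fun j : ℕ => |(∫ ω, FN T x0 (j + N) ω r ∂P) - ∫ ω, FN T x0 N ω r ∂P|)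
      atTop (𝓝 |(νa (Dset x0 r)).toReal - ∫ ω, FN T x0 N ω r ∂P|) :=
    (((tendsto_add_atTop_iff_nat N).2 hlim).sub_const _).abs
  refine le_of_tendsto hlim' (Eventually.of_forall fun j => ?_)
  have mp := hP.mp hm hp hp1 j
  have e : ∫ ω, FN T x0 N ω r ∂P = ∫ ω, FN T x0 N (sh j ω) r ∂P := by
    conv_lhs => rw [← mp.map_eq]
    rw [integral_map mp.aemeasurable
      ((FN_dep' T x0 N r).measurable hm).aestronglyMeasurable]
  have hi : Integrable (fun ω => FN T x0 N (sh j ω) r) P :=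
    mp.integrable_comp_of_integrable (hFNm N)
  rw [e, ← integral_sub (hFNm _) hi]
  have := norm_integral_le_of_norm_le_const (μ := P)
    (f := fun ω => FN T x0 (j + N) ω r - FN T x0 N (sh j ω) r)
    (ae_of_all _ fun ω => FN_compare S ω N j hN x0 r hr)
  simpa using this

/-- Existence of `b`. -/
lemma exists_b (S : Sys T Pop K Cd θ) (F : Fam Pop h ν) (hm : 1 ≤ m) {p : Fin m → ℝ}
    (hp : ∀ i, 0 < p i) (hp1 : ∑ i, p i = 1)
    {P : Measure (Om m)} [IsProbabilityMeasure P] (hP : Cyl p P)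
    {νa : Measure ℝ} (hνa : ∀ A : Set ℝ, MeasurableSet A → νa A = ∫⁻ ω, ν ω A ∂P)
    {cmin : ℝ} (hcmin : 0 < cmin)
    (hMin : ∀ (n : ℕ), 1 ≤ n → ∀ (ω : Om m), ∀ x ∈ Set.Icc (0 : ℝ) 1,
      cmin ≤ Pcomp Pop ω n (fun _ => 1) x)
    (x0 : ℝ) (hx0 : x0 ∈ Icc (0:ℝ) 1) :
    ∃ b : ℝ, 0 < b ∧
      Tendsto (fun ε : ℝ => (νa {x | |x - x0| < ε}).toReal / ε) (𝓝[>] (0 : ℝ)) (𝓝 b) ∧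
      Tendsto (fun N : ℕ => ∫ ω, LN T x0 N ω ∂P) atTop (𝓝 b) := by
  set bN : ℕ → ℝ := fun N => ∫ ω, LN T x0 N ω ∂P with hbN
  set G : ℝ → ℝ := fun r => (νa (Dset x0 r)).toReal / r with hG
  set e : ℕ → ℝ := fun N => Cd * θ ^ N * (K + 1) * 2 with he
  have he0 : Tendsto e atTop (𝓝 0) := by
    have := tendsto_pow_atTop_nhds_zero_of_lt_one S.hθ0.le S.hθ1
    simpa using ((this.const_mul Cd).mul_const (K + 1)).mul_const 2
  have hLNi : ∀ N, Integrable (fun ω => LN T x0 N ω) P := fun N => by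
    obtain ⟨C, hC0, hC⟩ := (LN_dep T x0 N).bounded hm
    exact Integrable.of_bound ((LN_dep T x0 N).measurable hm).aestronglyMeasurable C
      (ae_of_all _ hC)
  have hFNi : ∀ N r, Integrable (fun ω => FN T x0 N ω r) P := fun N r => by
    obtain ⟨C, hC0, hC⟩ := (FN_dep' T x0 N r).bounded hm
    exact Integrable.of_bound ((FN_dep' T x0 N r).measurable hm).aestronglyMeasurable C
      (ae_of_all _ hC)
  have key : ∀ N, 1 ≤ N → ∀ ε > 0, ∀ᶠ r in 𝓝[>] (0:ℝ), |G r - bN N| ≤ e N + ε := by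
    intro N hN ε hε
    filter_upwards [FN_unif hm S x0 hx0 N hε, self_mem_nhdsWithin] with r hr hr0
    have hr0' : (0:ℝ) < r := hr0
    have h1 := nua_FN S F hm hp hp1 hP hνa x0 N hN r hr0'.le
    have h2 : |(∫ ω, FN T x0 N ω r ∂P) - r * bN N| ≤ ε * r := by
      rw [hbN, ← integral_const_mul, ← integral_sub (hFNi N r) ((hLNi N).const_mul r)]
      have := norm_integral_le_of_norm_le_const (μ := P)
        (f := fun ω => FN T x0 N ω r - r * LN T x0 N ω) (ae_of_all _ hr)
      simpa using this
    have h3 : |(νa (Dset x0 r)).toReal - r * bN N| ≤ (e N + ε) * r := by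
      have := abs_sub_le (νa (Dset x0 r)).toReal (∫ ω, FN T x0 N ω r ∂P) (r * bN N)
      have e1 : Cd * θ ^ N * (K + 1) * (2 * r) = e N * r := by rw [he]; ring
      rw [e1] at h1
      linarith
    have e2 : G r - bN N = ((νa (Dset x0 r)).toReal - r * bN N) / r := by
      rw [hG]; field_simp
    rw [e2, abs_div, abs_of_pos hr0', div_le_iff₀ hr0']
    exact h3
  have hcau : CauchySeq bN := by
    rw [Metric.cauchySeq_iff']
    intro ε hε
    have h1 : ∀ᶠ N in atTop, e N < ε / 8 := he0.eventually (gt_mem_nhds (by linarith))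
    obtain ⟨N0, hN0⟩ := eventually_atTop.1 (h1.and (eventually_ge_atTop 1))
    refine ⟨N0, fun n hn => ?_⟩
    obtain ⟨r, hr1, hr2⟩ := ((key n (hN0 n hn).2 (ε/8) (by linarith)).and
      (key N0 (hN0 N0 le_rfl).2 (ε/8) (by linarith))).exists
    have a1 := (hN0 n hn).1
    have a2 := (hN0 N0 le_rfl).1
    rw [Real.dist_eq]
    rw [abs_le] at hr1 hr2
    rw [abs_lt]; constructor <;> linarith [hr1.1, hr1.2, hr2.1, hr2.2]
  obtain ⟨b, hb⟩ := cauchySeq_tendsto_of_complete hcau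
  have hGb : Tendsto G (𝓝[>] (0:ℝ)) (𝓝 b) := by
    rw [Metric.tendsto_nhds]
    intro ε hε
    have h1 : ∀ᶠ N in atTop, e N < ε / 4 := he0.eventually (gt_mem_nhds (by linarith))
    have h2 := Metric.tendsto_nhds.1 hb (ε/4) (by linarith)
    obtain ⟨N, hN1, hN2, hN3⟩ := (h1.and (h2.and (eventually_ge_atTop 1))).exists
    filter_upwards [key N hN3 (ε/4) (by linarith)] with r hr
    rw [Real.dist_eq] at *
    have := abs_sub_le (G r) (bN N) b
    linarith
  refine ⟨b, ?_, ?_, hb⟩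
  · refine hcmin.trans_le (ge_of_tendsto hb ?_)
    filter_upwards [eventually_ge_atTop 1] with N hN
    have := integral_mono (μ := P) (integrable_const cmin) (hLNi N)
      (fun ω => LN_ge S hcmin hMin x0 hx0 N hN ω)
    simpa using this
  · refine hGb.congr' ?_
    filter_upwards [self_mem_nhdsWithin] with r hr
    have hr0 : (0:ℝ) < r := hr
    have hsing : νa {x0} = 0 := by
      rw [hνa _ (measurableSet_singleton x0)]
      have : ∀ ω, ν ω {x0} = 0 := fun ω => by
        rw [F.nu]
        refine withDensity_absolutelyContinuous _ _ ?_
        rw [mLeb]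
        exact Measure.absolutelyContinuous_of_le Measure.restrict_le_self (by simp)
      simp [this]
    have : {x | |x - x0| < r} = Dset x0 r ∪ {x0} := by
      ext x
      simp only [mem_ofPred_eq, mem_union, mem_Dset, mem_singleton_iff]
      constructor
      · intro h
        by_cases hx : x = x0
        · exact Or.inr hx
        · exact Or.inl ⟨hx, h⟩
      · rintro (h | h)
        · exact h.2
        · simp [h, hr0]
    simp only [hG]
    rw [this, measure_congr (union_ae_eq_left_of_ae_eq_empty (ae_eq_empty.2 hsing))]

end

end

noncomputable section

section
variable {m : ℕ} {T : Fin m → ℝ → ℝ} {Pop : Fin m → (ℝ → ℝ) → ℝ → ℝ} {K Cd θ : ℝ}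

lemma hit_abs_le (S : Sys T Pop K Cd θ) (ω : Om m) (f : ℝ → ℝ) (hf : IsBV f) (j : ℕ)
    {A : Set ℝ} (hA : MeasurableSet A) :
    |hit T ω f j A| ≤ K * BVnorm f * mLeb.real A := by
  rw [hit, Pcomp_dual S.Tmeas S.dual S.popBV ω j f hf _ (ind_meas hA) (ind_bdd A),
    ← integral_abs_ind hA]
  exact abs_integral_mul_le (Pcomp_BV S.popBV ω j f hf) (S.bound ω j f hf)
    (integrable_of_bdd (ind_meas hA) (ind_bdd A))

lemma hit_Dset_le (S : Sys T Pop K Cd θ) (ω : Om m) (f : ℝ → ℝ) (hf : IsBV f) (j : ℕ)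
    (x0 r : ℝ) (hr : 0 ≤ r) :
    |hit T ω f j (Dset x0 r)| ≤ K * BVnorm f * (2 * r) := by
  refine (hit_abs_le S ω f hf j (measurableSet_Dset x0 r)).trans ?_
  have := S.hK
  have := BVnorm_nonneg f
  exact mul_le_mul_of_nonneg_left (mLeb_Dset_le x0 r hr) (by positivity)

lemma sum_shift_le (a : ℕ → ℝ) (C : ℝ) (hC : ∀ j, |a j| ≤ C) (L N : ℕ) :
    |∑ j ∈ Finset.range L, a j - ∑ j ∈ Finset.range L, a (j + N)| ≤ 2 * N * C := by
  have h1 : ∑ j ∈ Finset.range (N + L), a j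
      = ∑ j ∈ Finset.range N, a j + ∑ j ∈ Finset.range L, a (j + N) := by
    rw [Finset.sum_range_add]
    simp only [add_comm]
  have h2 : ∑ j ∈ Finset.range (L + N), a j
      = ∑ j ∈ Finset.range L, a j + ∑ j ∈ Finset.range N, a (L + j) := by
    rw [Finset.sum_range_add]
  have b1 : |∑ j ∈ Finset.range N, a j| ≤ N * C := by
    refine (Finset.abs_sum_le_sum_abs _ _).trans ?_
    refine (Finset.sum_le_sum fun j _ => hC j).trans ?_
    simp
  have b2 : |∑ j ∈ Finset.range N, a (L + j)| ≤ N * C := by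
    refine (Finset.abs_sum_le_sum_abs _ _).trans ?_
    refine (Finset.sum_le_sum fun j _ => hC (L + j)).trans ?_
    simp
  rw [add_comm N L, h2] at h1
  rw [abs_le] at *
  constructor <;> linarith [b1.1, b1.2, b2.1, b2.2]

lemma intensity (hm : 1 ≤ m) (S : Sys T Pop K Cd θ) (ω : Om m) (f : ℝ → ℝ) (hf : IsBV f)
    (hf1 : ∫ x, f x ∂mLeb = 1) (x0 : ℝ) (hx0 : x0 ∈ Icc (0:ℝ) 1) (bN : ℕ → ℝ) (b : ℝ)
    (hb : Tendsto bN atTop (𝓝 b))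
    (hsl : ∀ N, 1 ≤ N → Tendsto (fun n : ℕ => (∑ j ∈ Finset.range n, LN T x0 N (sh j ω)) / n)
      atTop (𝓝 (bN N)))
    (c t : ℝ) (hc : 0 ≤ c) (ht : 0 ≤ t) :
    Tendsto (fun n : ℕ => ∑ j ∈ Finset.range ⌊t * n⌋₊, hit T ω f j (Dset x0 (c / n))) atTop
      (𝓝 (t * c * b)) := by
  rcases hc.eq_or_lt with rfl | hc
  · have : Dset x0 0 = ∅ := by
      ext x; simp only [mem_Dset, mem_empty_iff_false, iff_false, not_and, not_lt]
      exact fun _ => abs_nonneg _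
    simp [this, hit]
  rcases ht.eq_or_lt with rfl | ht
  · simp
  set L : ℕ → ℕ := fun n => ⌊t * (n:ℝ)⌋₊ with hL
  have hLn : Tendsto (fun n : ℕ => (L n : ℝ) / n) atTop (𝓝 t) :=
    (tendsto_nat_floor_mul_div_atTop ht.le).comp tendsto_natCast_atTop_atTop
  have hLinf : Tendsto L atTop atTop :=
    tendsto_nat_floor_atTop.comp (tendsto_natCast_atTop_atTop.const_mul_atTop ht)
  set Bn : ℕ → ℕ → ℝ := fun N n => (c / n) * ∑ j ∈ Finset.range (L n), LN T x0 N (sh j ω) with hBn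
  have hBlim : ∀ N, 1 ≤ N → Tendsto (Bn N) atTop (𝓝 (c * t * bN N)) := by
    intro N hN
    have h1 := ((hLn.const_mul c).mul ((hsl N hN).comp hLinf))
    refine h1.congr' ?_
    filter_upwards [hLinf.eventually (eventually_ge_atTop 1)] with n hn
    have : (L n : ℝ) ≠ 0 := by positivity
    simp only [hBn, Function.comp]
    field_simp
  set B := K * BVnorm f with hB
  have hB0 : 0 ≤ B := by have := S.hK; have := BVnorm_nonneg f; positivity
  set e : ℕ → ℝ := fun N => Cd * θ ^ N * (B + 1) * 2 with he
  have he0 : Tendsto e atTop (𝓝 0) := by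
    have := tendsto_pow_atTop_nhds_zero_of_lt_one S.hθ0.le S.hθ1
    simpa using ((this.const_mul Cd).mul_const (B + 1)).mul_const 2
  have hr0 : Tendsto (fun n : ℕ => c / (n:ℝ)) atTop (𝓝[>] 0) := by
    rw [tendsto_nhdsWithin_iff]
    refine ⟨tendsto_const_div_atTop_nhds_zero_nat c, ?_⟩
    filter_upwards [eventually_ge_atTop 1] with n hn
    have : (0:ℝ) < n := by exact_mod_cast hn
    exact div_pos hc this
  have hbound : ∀ N, 1 ≤ N → ∀ ε > 0, ∀ᶠ n : ℕ in atTop,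
      |∑ j ∈ Finset.range (L n), hit T ω f j (Dset x0 (c / n)) - Bn N n|
        ≤ 2 * N * (B * 2) * (c / n) + (e N + ε) * (c * t) := by
    intro N hN ε hε
    filter_upwards [hr0.eventually (FN_unif hm S x0 hx0 N hε), eventually_ge_atTop 1] with n hn hn1
    have hnp : (0:ℝ) < n := by exact_mod_cast hn1
    set r := c / (n:ℝ) with hr
    have hrp : 0 < r := div_pos hc hnp
    have s1 := sum_shift_le (fun j => hit T ω f j (Dset x0 r)) (B * (2 * r))
      (fun j => hit_Dset_le S ω f hf j x0 r hrp.le) (L n) N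
    have s2 : |∑ j ∈ Finset.range (L n), hit T ω f (j + N) (Dset x0 r) - Bn N n|
        ≤ (L n) * ((e N + ε) * r) := by
      simp only [hBn]
      rw [Finset.mul_sum, ← Finset.sum_sub_distrib]
      refine (Finset.abs_sum_le_sum_abs _ _).trans ?_
      have : ∀ j ∈ Finset.range (L n), |hit T ω f (j + N) (Dset x0 r)
          - c / n * LN T x0 N (sh j ω)| ≤ (e N + ε) * r := by
        intro j _
        have c1 := hit_compare S ω N j hN f hf hf1 x0 r hrp.le
        have c2 := hn (sh j ω)
        have c3 := abs_sub_le (hit T ω f (j + N) (Dset x0 r)) (FN T x0 N (sh j ω) r)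
          (r * LN T x0 N (sh j ω))
        have e1 : Cd * θ ^ N * (B + 1) * (2 * r) = e N * r := by rw [he]; ring
        rw [← hB, e1] at c1
        rw [← hr]
        linarith
      refine (Finset.sum_le_sum this).trans ?_
      simp
    have s3 : (L n : ℝ) * ((e N + ε) * r) ≤ (e N + ε) * (c * t) := by
      have f1 : (L n : ℝ) ≤ t * n := Nat.floor_le (by positivity)
      have f2 : (L n : ℝ) * r ≤ c * t := by
        calc (L n : ℝ) * r ≤ t * n * r := by gcongr
          _ = c * t := by rw [hr]; field_simp
      have f3 : 0 ≤ e N + ε := by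
        have := S.hCd; have := S.hθ0; simp only [he]; positivity
      nlinarith
    have s4 := abs_sub_le (∑ j ∈ Finset.range (L n), hit T ω f j (Dset x0 r))
      (∑ j ∈ Finset.range (L n), hit T ω f (j + N) (Dset x0 r)) (Bn N n)
    have e2 : 2 * (N:ℝ) * (B * (2 * r)) = 2 * N * (B * 2) * r := by ring
    rw [e2] at s1
    linarith
  rw [Metric.tendsto_nhds]
  intro η hη
  have hct : 0 < c * t := by positivity
  -- choose N
  have g1 : ∀ᶠ N in atTop, e N * (c * t) < η / 6 := by
    have : Tendsto (fun N => e N * (c * t)) atTop (𝓝 0) := by simpa using he0.mul_const (c * t)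
    exact this.eventually (gt_mem_nhds (by linarith))
  have g2 := Metric.tendsto_nhds.1 (hb.const_mul (c * t)) (η / 6) (by linarith)
  obtain ⟨N, hN1, hN2, hN3⟩ := (g1.and (g2.and (eventually_ge_atTop 1))).exists
  have hε : 0 < η / (6 * (c * t)) := by positivity
  have g3 : ∀ᶠ n : ℕ in atTop, 2 * N * (B * 2) * (c / n) < η / 6 := by
    have : Tendsto (fun n : ℕ => 2 * N * (B * 2) * (c / (n:ℝ))) atTop (𝓝 0) := by
      simpa using (tendsto_const_div_atTop_nhds_zero_nat c).const_mul (2 * N * (B * 2))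
    exact this.eventually (gt_mem_nhds (by linarith))
  have g4 := Metric.tendsto_nhds.1 (hBlim N hN3) (η / 6) (by linarith)
  filter_upwards [hbound N hN3 _ hε, g3, g4] with n k1 k2 k3
  have e3 : (e N + η / (6 * (c * t))) * (c * t) = e N * (c * t) + η / 6 := by
    field_simp
  rw [e3] at k1
  rw [Real.dist_eq] at *
  have e4 : t * c * b = c * t * b := by ring
  rw [e4]
  rw [abs_lt] at *
  rw [abs_le] at k1
  constructor <;> linarith [k1.1, k1.2, k3.1, k3.2, hN2.1, hN2.2]

end

end

noncomputable section

section
variable {m : ℕ} {T : Fin m → ℝ → ℝ} {Pop : Fin m → (ℝ → ℝ) → ℝ → ℝ} {K Cd θ : ℝ}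
  {h : Om m → ℝ → ℝ} {ν : Om m → Measure ℝ}

/-- survival from time `j` on -/
def Qs (T : Fin m → ℝ → ℝ) (ω : Om m) (A : ℕ → Set ℝ) (j : ℕ) : Set ℝ :=
  {x | ∀ i, j ≤ i → randComp T ω i x ∉ A i}

lemma Qs_meas (hT : ∀ i, Measurable (T i)) (ω : Om m) {A : ℕ → Set ℝ}
    (hA : ∀ i, MeasurableSet (A i)) (j : ℕ) : MeasurableSet (Qs T ω A j) := by
  have : Qs T ω A j = ⋂ i, ⋂ (_ : j ≤ i), (randComp T ω i ⁻¹' A i)ᶜ := by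
    ext x; simp [Qs]
  rw [this]
  exact MeasurableSet.iInter fun i => MeasurableSet.iInter fun _ =>
    (randComp_measurable hT ω i (hA i)).compl

lemma Qs_shift (ω : Om m) (A : ℕ → Set ℝ) (j : ℕ) :
    Qs T ω A j = randComp T ω j ⁻¹' Qs T (sh j ω) (fun i => A (j + i)) 0 := by
  ext x
  simp only [Qs, mem_ofPred_eq, mem_preimage, ← randComp_add]
  constructor
  · intro hx i _; exact hx _ (by omega)
  · intro hx i hi
    have := hx (i - j) (by omega)
    rwa [Nat.add_sub_cancel' hi] at this

lemma Qs_succ (ω : Om m) (A : ℕ → Set ℝ) (j : ℕ) :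
    Qs T ω A j = Qs T ω A (j + 1) \ (randComp T ω j ⁻¹' A j) := by
  ext x
  simp only [Qs, mem_ofPred_eq, Set.mem_sdiff, mem_preimage]
  constructor
  · intro hx; exact ⟨fun i hi => hx i (by omega), hx j le_rfl⟩
  · rintro ⟨h1, h2⟩ i hi
    rcases hi.eq_or_lt with rfl | hi
    · exact h2
    · exact h1 i hi

lemma Qs_mono (ω : Om m) (A : ℕ → Set ℝ) {j l : ℕ} (hjl : j ≤ l) :
    Qs T ω A j ⊆ Qs T ω A l := fun _ hx i hi => hx i (hjl.trans hi)

lemma mixing (S : Sys T Pop K Cd θ) (F : Fam Pop h ν) (ω : Om m) (j l : ℕ) (hl : 1 ≤ l)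
    {A W : Set ℝ} (hA : MeasurableSet A) (hW : MeasurableSet W) {V : ℝ} (hV0 : 0 ≤ V)
    (hV : eVariationOn (A.indicator (fun _ => (1:ℝ))) (Icc 0 1) ≤ ENNReal.ofReal V) :
    |(ν ω).real (randComp T ω j ⁻¹' A ∩ randComp T ω (j + l) ⁻¹' W)
      - (ν ω).real (randComp T ω j ⁻¹' A) * (ν ω).real (randComp T ω (j + l) ⁻¹' W)|
      ≤ Cd * θ ^ l * ((2 + V) * (K * BVnorm (h ω))) * mLeb.real W := by
  have hpr := F.prob
  set H := Pcomp Pop ω j (h ω) with hH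
  have hHBV : IsBV H := Pcomp_BV S.popBV ω j _ (F.bv ω)
  set c := (ν ω).real (randComp T ω j ⁻¹' A) with hc
  have hc0 : 0 ≤ c := measureReal_nonneg
  have hc1 : c ≤ 1 := measureReal_le_one
  have hTj := randComp_measurable S.Tmeas ω j
  have hTl := randComp_measurable S.Tmeas (sh j ω) l
  have cA : c = ∫ x, ind A x * H x ∂mLeb := by
    rw [hc, Measure.real, ← F.hit_eq S ω j hA, hit,
      Pcomp_dual S.Tmeas S.dual S.popBV ω j _ (F.bv ω) _ (ind_meas hA) (ind_bdd A)]
  have cW : (ν ω).real (randComp T ω (j + l) ⁻¹' W)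
      = ∫ x, ind W (randComp T (sh j ω) l x) * H x ∂mLeb := by
    rw [Measure.real, ← F.hit_eq S ω (j + l) hW, hit,
      push S ω j l _ (F.bv ω) _ (ind_meas hW) (ind_bdd W)]
  have cAW : (ν ω).real (randComp T ω j ⁻¹' A ∩ randComp T ω (j + l) ⁻¹' W)
      = ∫ x, ind W (randComp T (sh j ω) l x) * (ind A x * H x) ∂mLeb := by
    have e : randComp T ω j ⁻¹' A ∩ randComp T ω (j + l) ⁻¹' W
        = randComp T ω j ⁻¹' (A ∩ randComp T (sh j ω) l ⁻¹' W) := by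
      ext x; simp [randComp_add]
    have hm1 : MeasurableSet (A ∩ randComp T (sh j ω) l ⁻¹' W) := hA.inter (hTl hW)
    rw [e, Measure.real, ← F.hit_eq S ω j hm1, hit,
      Pcomp_dual S.Tmeas S.dual S.popBV ω j _ (F.bv ω) _ (ind_meas hm1) (ind_bdd _)]
    congr 1; ext x
    by_cases h1 : x ∈ A <;> by_cases h2 : randComp T (sh j ω) l x ∈ W <;>
      simp [ind, indicator, h1, h2, hH]
  obtain ⟨hbv, hbn⟩ := hHBV.indicator_sub_mul hA hV0 hV (c := c) (by rw [abs_of_nonneg hc0]; exact hc1)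
  have iA : Integrable (fun x => ind A x * H x) mLeb := by
    obtain ⟨C, hC⟩ := ind_bdd A
    exact hHBV.1.bdd_mul (c := C) (ind_meas hA).aestronglyMeasurable (ae_of_all _ hC)
  have wm : Measurable fun x => ind W (randComp T (sh j ω) l x) := (ind_meas hW).comp hTl
  obtain ⟨CW, hCW⟩ := ind_bdd W
  have hint : ∫ x, (ind A x - c) * H x ∂mLeb = 0 := by
    have : (fun x => (ind A x - c) * H x) = fun x => ind A x * H x - c * H x := by
      ext x; ring
    rw [this, integral_sub iA (hHBV.1.const_mul c), integral_const_mul, ← cA, hH,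
      integral_Pcomp S ω j _ (F.bv ω), F.int1]
    ring
  have hB : BVnorm (fun x => (ind A x - c) * H x) ≤ (2 + V) * (K * BVnorm (h ω)) :=
    hbn.trans (mul_le_mul_of_nonneg_left (S.bound ω j _ (F.bv ω)) (by linarith))
  have := S.DC (sh j ω) l hl _ hbv hint hB (ind W) (ind_meas hW) (ind_bdd W)
  rw [integral_abs_ind hW] at this
  refine le_trans (le_of_eq ?_) this
  congr 1
  rw [cAW, cW, ← integral_const_mul, ← integral_sub]
  · congr 1; ext x; ring
  · exact iA.bdd_mul (c := CW) wm.aestronglyMeasurable (ae_of_all _ fun x => hCW _)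
  · exact (hHBV.1.bdd_mul (c := CW) wm.aestronglyMeasurable
      (ae_of_all _ fun x => hCW _)).const_mul c

lemma geom_tail (hθ0 : 0 < θ) (hθ1 : θ < 1) (ℓ g : ℕ) :
    ∑ l ∈ Finset.range g, (if l ≤ ℓ then 0 else θ ^ l) ≤ θ ^ ℓ / (1 - θ) := by
  have h1 : ∀ l ∈ Finset.range g, (if l ≤ ℓ then 0 else θ ^ l)
      ≤ if ℓ ≤ l then θ ^ l else 0 := by
    intro l _
    by_cases h : l ≤ ℓ
    · by_cases h' : ℓ ≤ l <;> simp [h, h']; positivity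
    · simp [h, (not_le.1 h).le]
  refine (Finset.sum_le_sum h1).trans ?_
  rw [← Finset.sum_filter]
  calc ∑ l ∈ Finset.range g with ℓ ≤ l, θ ^ l ≤ ∑ l ∈ Finset.Ico ℓ (ℓ + g), θ ^ l := by
        apply Finset.sum_le_sum_of_subset_of_nonneg
        · intro l hl
          simp only [Finset.mem_filter, Finset.mem_range, Finset.mem_Ico] at *
          omega
        · intros; positivity
    _ = θ ^ ℓ * ∑ l ∈ Finset.range g, θ ^ l := by
        rw [Finset.sum_Ico_eq_sum_range, Finset.mul_sum]
        simp [pow_add]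
    _ ≤ θ ^ ℓ * (1 - θ)⁻¹ := by
        gcongr
        rw [← tsum_geometric_of_lt_one hθ0.le hθ1]
        exact (summable_geometric_of_lt_one hθ0.le hθ1).sum_le_tsum _ (fun _ _ => by positivity)
    _ = _ := by rw [div_eq_mul_inv]

/-- one-step estimate -/
lemma void_step (S : Sys T Pop K Cd θ) (F : Fam Pop h ν) (ω : Om m) (x0 r : ℝ) (hr : 0 ≤ r)
    {A : ℕ → Set ℝ} (hA : ∀ i, MeasurableSet (A i)) (hAD : ∀ i, A i ⊆ Dset x0 r)
    {V : ℝ} (hV0 : 0 ≤ V)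
    (hV : ∀ i, eVariationOn ((A i).indicator (fun _ => (1:ℝ))) (Icc 0 1) ≤ ENNReal.ofReal V)
    (ℓ g : ℕ) (hg : 1 ≤ g)
    (hret : ∀ l, 1 ≤ l → l ≤ ℓ → ∀ ω' : Om m, ∀ x ∈ Dset x0 r, randComp T ω' l x ∉ Dset x0 r)
    {B G : ℝ} (hB : B = 2 * (K * BVnorm (h ω)) * r) (hG : G = Cd * ((2 + V) * (K * BVnorm (h ω))))
    (hB1 : B ≤ 1)
    (j : ℕ) :
    |(ν ω).real (Qs T ω A j)
      - Real.exp (-(ν ω).real (randComp T ω j ⁻¹' A j)) * (ν ω).real (Qs T ω A (j + 1))|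
      ≤ g * B ^ 2 + G * (2 * r) * (θ ^ ℓ / (1 - θ)) + G * θ ^ g + g * B ^ 2 + B ^ 2 := by
  have hpr := F.prob
  have hθ0 := S.hθ0
  have hK := S.hK
  have hCd := S.hCd
  have hBV0 := BVnorm_nonneg (h ω)
  have hG0 : 0 ≤ G := by rw [hG]; positivity
  have hB0 : 0 ≤ B := by rw [hB]; positivity
  have hD := measurableSet_Dset x0 r
  set μ := ν ω with hμ
  set E : ℕ → Set ℝ := fun i => randComp T ω i ⁻¹' A i with hE
  have hEm : ∀ i, MeasurableSet (E i) := fun i => randComp_measurable S.Tmeas ω i (hA i)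
  have hDB : ∀ i, μ.real (randComp T ω i ⁻¹' Dset x0 r) ≤ B := by
    intro i
    rw [Measure.real, ← F.hit_eq S ω i hD, hB]
    refine (le_abs_self _).trans ((hit_Dset_le S ω _ (F.bv ω) i x0 r hr).trans (le_of_eq ?_))
    ring
  have hEB : ∀ i, μ.real (E i) ≤ B := fun i =>
    (measureReal_mono (preimage_mono (hAD i))).trans (hDB i)
  set Q := Qs T ω A with hQ
  have hQm : ∀ i, MeasurableSet (Q i) := fun i => Qs_meas S.Tmeas ω hA i
  -- recursion
  have r1 : μ.real (Q j) = μ.real (Q (j+1)) - μ.real (E j ∩ Q (j+1)) := by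
    have e : Q j = Q (j+1) \ (E j) := Qs_succ ω A j
    have := measureReal_inter_add_sdiff (μ := μ) (s := Q (j+1)) (hEm j)
    rw [e, inter_comm (E j)]; linarith
  -- gap: set inclusion
  have incl : Q (j + g) ⊆ Q (j+1) ∪ ⋃ l ∈ Finset.range g, if 1 ≤ l then E (j + l) else ∅ := by
    intro x hx
    by_cases hx1 : x ∈ Q (j+1)
    · exact Or.inl hx1
    · right
      simp only [hQ, Qs, mem_ofPred_eq, not_forall, not_not] at hx1
      obtain ⟨i, hi, hxi⟩ := hx1
      have hlt : i < j + g := by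
        by_contra hcon
        exact hx i (not_lt.1 hcon) hxi
      simp only [mem_iUnion, Finset.mem_range]
      refine ⟨i - j, by omega, ?_⟩
      rw [if_pos (by omega), Nat.add_sub_cancel' (by omega)]
      exact hxi
  have short : ∀ l ∈ Finset.range g, μ.real (E j ∩ if 1 ≤ l then E (j + l) else ∅)
      ≤ B ^ 2 + G * (2 * r) * (if l ≤ ℓ then 0 else θ ^ l) := by
    intro l _
    have hpos : 0 ≤ B ^ 2 + G * (2 * r) * (if l ≤ ℓ then 0 else θ ^ l) := by
      split_ifs <;> positivity
    by_cases h1 : 1 ≤ l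
    · rw [if_pos h1]
      by_cases h2 : l ≤ ℓ
      · have : E j ∩ E (j + l) = ∅ := by
          ext x
          simp only [mem_inter_iff, mem_empty_iff_false, iff_false, not_and]
          intro hx1 hx2
          simp only [hE, mem_preimage] at hx1 hx2
          rw [randComp_add] at hx2
          exact hret l h1 h2 _ _ (hAD _ hx1) (hAD _ hx2)
        rw [this]; simpa using hpos
      · rw [if_neg h2]
        have m1 := mixing S F ω j l h1 (hA j) hD hV0 (hV j)
        have m2 : μ.real (E j ∩ E (j + l))
            ≤ μ.real (randComp T ω j ⁻¹' A j ∩ randComp T ω (j + l) ⁻¹' Dset x0 r) :=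
          measureReal_mono (inter_subset_inter_right _ (preimage_mono (hAD _)))
        have m3 : μ.real (randComp T ω j ⁻¹' A j) * μ.real (randComp T ω (j + l) ⁻¹' Dset x0 r)
            ≤ B ^ 2 := by
          rw [sq]
          exact mul_le_mul (hEB j) (hDB _) measureReal_nonneg hB0
        have m4 : Cd * θ ^ l * ((2 + V) * (K * BVnorm (h ω))) * mLeb.real (Dset x0 r)
            ≤ G * (2 * r) * θ ^ l := by
          rw [hG]
          calc _ ≤ Cd * θ ^ l * ((2 + V) * (K * BVnorm (h ω))) * (2 * r) := by
                gcongr; exact mLeb_Dset_le x0 r hr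
            _ = _ := by ring
        have := (abs_le.1 m1).2
        linarith
    · rw [if_neg h1]; simpa using hpos
  have r2 : μ.real (E j ∩ Q (j+g)) ≤ μ.real (E j ∩ Q (j+1))
      + (g * B ^ 2 + G * (2 * r) * (θ ^ ℓ / (1 - θ))) := by
    have i1 : E j ∩ Q (j+g) ⊆ (E j ∩ Q (j+1))
        ∪ ⋃ l ∈ Finset.range g, (E j ∩ if 1 ≤ l then E (j + l) else ∅) := by
      intro x hx
      rcases incl hx.2 with h1 | h1
      · exact Or.inl ⟨hx.1, h1⟩
      · right
        simp only [mem_iUnion] at h1 ⊢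
        obtain ⟨l, hl, hxl⟩ := h1
        exact ⟨l, hl, hx.1, hxl⟩
    refine (measureReal_mono i1).trans ((measureReal_union_le _ _).trans ?_)
    gcongr
    refine (measureReal_biUnion_finset_le _ _).trans ((Finset.sum_le_sum short).trans ?_)
    rw [Finset.sum_add_distrib, ← Finset.mul_sum]
    have := geom_tail S.hθ0 S.hθ1 ℓ g
    simp only [Finset.sum_const, Finset.card_range, nsmul_eq_mul]
    gcongr
  have r3 : μ.real (Q (j+g)) ≤ μ.real (Q (j+1)) + g * B := by
    refine (measureReal_mono incl).trans ((measureReal_union_le _ _).trans ?_)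
    gcongr
    refine (measureReal_biUnion_finset_le _ _).trans ?_
    have : ∀ l ∈ Finset.range g, μ.real (if 1 ≤ l then E (j + l) else ∅) ≤ B := by
      intro l _
      split_ifs
      · exact hEB _
      · simpa using hB0
    refine (Finset.sum_le_sum this).trans ?_
    simp
  have r2' : μ.real (E j ∩ Q (j+1)) ≤ μ.real (E j ∩ Q (j+g)) :=
    measureReal_mono (inter_subset_inter_right _ (Qs_mono ω A (by omega)))
  have r3' : μ.real (Q (j+1)) ≤ μ.real (Q (j+g)) :=
    measureReal_mono (Qs_mono ω A (by omega))
  have r4 : |μ.real (E j ∩ Q (j+g)) - μ.real (E j) * μ.real (Q (j+g))| ≤ G * θ ^ g := by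
    have hWm : MeasurableSet (Qs T (sh (j+g) ω) (fun i => A (j + g + i)) 0) :=
      Qs_meas S.Tmeas _ (fun i => hA _) 0
    have m1 := mixing S F ω j g hg (hA j) hWm hV0 (hV j)
    rw [← Qs_shift] at m1
    refine m1.trans ?_
    rw [hG]
    calc _ ≤ Cd * θ ^ g * ((2 + V) * (K * BVnorm (h ω))) * 1 := by
          gcongr; exact measureReal_le_one
      _ = _ := by ring
  set a := μ.real (E j) with ha
  have ha0 : 0 ≤ a := measureReal_nonneg
  have haB : a ≤ B := hEB j
  have r5 := Real.abs_exp_sub_one_sub_id_le (x := -a) (by rw [abs_neg, abs_of_nonneg ha0]; linarith)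
  have q0 : 0 ≤ μ.real (Q (j+1)) := measureReal_nonneg
  have q1 : μ.real (Q (j+1)) ≤ 1 := measureReal_le_one
  set q := μ.real (Q (j+1)) with hq
  have r6 : |Real.exp (-a) * q - (1 - a) * q| ≤ B ^ 2 := by
    rw [← sub_mul, abs_mul, abs_of_nonneg q0]
    have : |Real.exp (-a) - (1 - a)| ≤ B ^ 2 := by
      have e : Real.exp (-a) - (1 - a) = Real.exp (-a) - 1 - -a := by ring
      rw [e]; refine r5.trans ?_
      nlinarith
    nlinarith [abs_nonneg (Real.exp (-a) - (1 - a)), sq_nonneg B]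
  have r7 : a * μ.real (Q (j+g)) - a * q ≤ g * B ^ 2 := by
    have : a * (μ.real (Q (j+g)) - q) ≤ B * (g * B) :=
      mul_le_mul haB (by linarith) (by linarith) hB0
    nlinarith
  have r7' : 0 ≤ a * μ.real (Q (j+g)) - a * q := by
    have := mul_le_mul_of_nonneg_left r3' ha0
    linarith
  have p1 : 0 ≤ (g:ℝ) * B ^ 2 := by positivity
  have p2 : 0 ≤ G * (2 * r) * (θ ^ ℓ / (1 - θ)) := by
    have : 0 < 1 - θ := by linarith [S.hθ1]
    positivity
  have p3 : 0 ≤ G * θ ^ g := by positivity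
  rw [abs_le] at r4 r6 ⊢
  change -_ ≤ μ.real (Q j) - Real.exp (-a) * q ∧ μ.real (Q j) - Real.exp (-a) * q ≤ _
  rw [r1]
  constructor <;> nlinarith [r4.1, r4.2, r6.1, r6.2]

/-- telescoped estimate -/
lemma void_tele (ν : Om m → Measure ℝ) (ω : Om m)
    {A : ℕ → Set ℝ} {δ : ℝ}
    (hstep : ∀ j, |(ν ω).real (Qs T ω A j)
      - Real.exp (-(ν ω).real (randComp T ω j ⁻¹' A j)) * (ν ω).real (Qs T ω A (j + 1))| ≤ δ)
    (L : ℕ) :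
    |(ν ω).real (Qs T ω A 0)
      - Real.exp (-∑ j ∈ Finset.range L, (ν ω).real (randComp T ω j ⁻¹' A j))
        * (ν ω).real (Qs T ω A L)| ≤ L * δ := by
  induction L with
  | zero => simp
  | succ L ih =>
    rw [Finset.sum_range_succ, neg_add, Real.exp_add]
    have h1 := hstep L
    set X := Real.exp (-∑ j ∈ Finset.range L, (ν ω).real (randComp T ω j ⁻¹' A j)) with hX
    have hX0 : 0 ≤ X := (Real.exp_pos _).le
    have hX1 : X ≤ 1 := by
      rw [hX, Real.exp_le_one_iff, neg_nonpos]
      exact Finset.sum_nonneg fun _ _ => measureReal_nonneg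
    have h2 : |X * (ν ω).real (Qs T ω A L) - X * Real.exp (-(ν ω).real (randComp T ω L ⁻¹' A L))
        * (ν ω).real (Qs T ω A (L + 1))| ≤ δ := by
      rw [mul_assoc, ← mul_sub, abs_mul, abs_of_nonneg hX0]
      nlinarith [abs_nonneg ((ν ω).real (Qs T ω A L)
        - Real.exp (-(ν ω).real (randComp T ω L ⁻¹' A L)) * (ν ω).real (Qs T ω A (L + 1)))]
    have h3 := abs_sub_le ((ν ω).real (Qs T ω A 0)) (X * (ν ω).real (Qs T ω A L))
      (X * Real.exp (-(ν ω).real (randComp T ω L ⁻¹' A L)) * (ν ω).real (Qs T ω A (L + 1)))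
    push_cast
    linarith

lemma no_return (hm : 1 ≤ m) (T : Fin m → ℝ → ℝ) (x0 : ℝ)
    (hx0cont : ∀ (ω : Om m) (n : ℕ), 1 ≤ n → ContinuousAt (randComp T ω n) x0)
    (hx0np : ∀ (ω : Om m) (n : ℕ), 1 ≤ n → randComp T ω n x0 ≠ x0) (ℓ : ℕ) :
    ∀ᶠ r in 𝓝[>] (0:ℝ), ∀ l, 1 ≤ l → l ≤ ℓ → ∀ ω' : Om m, ∀ x ∈ Dset x0 r,
      randComp T ω' l x ∉ Dset x0 r := by
  have h1 : ∀ l : ℕ, 1 ≤ l → ∀ᶠ r in 𝓝[>] (0:ℝ), ∀ w : Fin l → Fin m, ∀ x ∈ Dset x0 r,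
      randComp T (extW hm w) l x ∉ Dset x0 r := by
    intro l hl
    rw [eventually_all]
    intro w
    set y := randComp T (extW hm w) l x0 with hy
    have hne : 0 < |y - x0| := abs_pos.2 (sub_ne_zero.2 (hx0np _ l hl))
    obtain ⟨δ, hδ, hd⟩ := Metric.continuousAt_iff.1 (hx0cont (extW hm w) l hl) (|y - x0| / 2)
      (by linarith)
    filter_upwards [Ioo_mem_nhdsGT hδ, Ioo_mem_nhdsGT (show 0 < |y - x0| / 2 by linarith)]
      with r hr hr' x hx hx'
    rw [mem_Dset] at hx hx'
    have a1 := hd (x := x) (by rw [Real.dist_eq]; linarith [hx.2, hr.2])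
    rw [Real.dist_eq, ← hy, abs_sub_comm] at a1
    have a2 := abs_sub_le y (randComp T (extW hm w) l x) x0
    linarith [hx'.2, hr'.2]
  have h2 : ∀ᶠ r in 𝓝[>] (0:ℝ), ∀ l ∈ Finset.Icc 1 ℓ, ∀ w : Fin l → Fin m, ∀ x ∈ Dset x0 r,
      randComp T (extW hm w) l x ∉ Dset x0 r := by
    rw [Filter.eventually_all_finset]
    intro l hl
    exact h1 l (Finset.mem_Icc.1 hl).1
  filter_upwards [h2] with r hr l hl1 hl2 ω' x hx
  have e : randComp T ω' l = randComp T (extW hm (fun i : Fin l => ω' (i : ℕ))) l :=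
    DepOn.eq_ext (N := l) (g := fun ω => randComp T ω l) hm
      (fun a b hab => randComp_congr T a b l hab) ω'
  rw [e]
  exact hr l (Finset.mem_Icc.2 ⟨hl1, hl2⟩) _ x hx

lemma sqrt_tendsto : Tendsto Nat.sqrt atTop atTop := by
  refine tendsto_atTop.2 fun b => ?_
  filter_upwards [eventually_ge_atTop (b * b)] with n hn
  exact Nat.le_sqrt.2 hn

lemma sqrt_div_tendsto : Tendsto (fun n : ℕ => (Nat.sqrt n : ℝ) / n) atTop (𝓝 0) := by
  have h1 : Tendsto (fun n : ℕ => (1:ℝ) / (Nat.sqrt n : ℝ)) atTop (𝓝 0) :=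
    (tendsto_const_div_atTop_nhds_zero_nat 1).comp sqrt_tendsto
  refine squeeze_zero' (Eventually.of_forall fun n => by positivity) ?_ h1
  filter_upwards [eventually_ge_atTop 1] with n hn
  have hs : 0 < Nat.sqrt n := Nat.sqrt_pos.2 hn
  have hs' : (0:ℝ) < Nat.sqrt n := by exact_mod_cast hs
  have hn' : (0:ℝ) < n := by exact_mod_cast hn
  rw [div_le_div_iff₀ hn' hs', one_mul]
  exact_mod_cast Nat.sqrt_le n

lemma n_pow_sqrt (hθ0 : 0 < θ) (hθ1 : θ < 1) :
    Tendsto (fun n : ℕ => (n:ℝ) * θ ^ (Nat.sqrt n)) atTop (𝓝 0) := by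
  have h0 := tendsto_pow_const_mul_const_pow_of_abs_lt_one 2
    (show |θ| < 1 by rwa [abs_of_pos hθ0])
  have h1 := ((h0.comp (tendsto_add_atTop_nat 1)).comp sqrt_tendsto).const_mul θ⁻¹
  rw [mul_zero] at h1
  refine squeeze_zero (fun n => by positivity) (fun n => ?_) h1
  simp only [Function.comp]
  have : (n:ℝ) ≤ ((Nat.sqrt n + 1 : ℕ) : ℝ) ^ 2 := by
    have := Nat.lt_succ_sqrt n
    have h2 : n ≤ (Nat.sqrt n + 1) ^ 2 := by rw [sq]; exact this.le
    exact_mod_cast h2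
  calc (n:ℝ) * θ ^ (Nat.sqrt n) ≤ ((Nat.sqrt n + 1 : ℕ) : ℝ) ^ 2 * θ ^ (Nat.sqrt n) := by gcongr
    _ = _ := by rw [pow_succ θ]; field_simp

/-- The void probability limit. -/
lemma void_limit (hm : 1 ≤ m) (S : Sys T Pop K Cd θ) (F : Fam Pop h ν) (ω : Om m) (x0 : ℝ)
    (hx0cont : ∀ (ω : Om m) (n : ℕ), 1 ≤ n → ContinuousAt (randComp T ω n) x0)
    (hx0np : ∀ (ω : Om m) (n : ℕ), 1 ≤ n → randComp T ω n x0 ≠ x0)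
    (A : ℕ → ℕ → Set ℝ) (hA : ∀ n i, MeasurableSet (A n i)) (c : ℝ) (hc : 0 < c)
    (hAD : ∀ n i, 1 ≤ n → A n i ⊆ Dset x0 (c / n)) {V : ℝ} (hV0 : 0 ≤ V)
    (hV : ∀ n i, 1 ≤ n → eVariationOn ((A n i).indicator (fun _ => (1:ℝ))) (Icc 0 1)
      ≤ ENNReal.ofReal V)
    (L : ℕ → ℕ) (C0 : ℝ) (hC0 : 0 ≤ C0) (hL : ∀ n, (L n : ℝ) ≤ C0 * n)
    (hAL : ∀ n i, 1 ≤ n → L n ≤ i → A n i = ∅) (Λ : ℝ)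
    (hΛ : Tendsto (fun n => ∑ j ∈ Finset.range (L n), hit T ω (h ω) j (A n j)) atTop (𝓝 Λ)) :
    Tendsto (fun n => (ν ω).real (Qs T ω (A n) 0)) atTop (𝓝 (Real.exp (-Λ))) := by
  have hpr := F.prob
  have hθ0 := S.hθ0
  have hθ1 : 0 < 1 - θ := by linarith [S.hθ1]
  have hK := S.hK
  have hCd := S.hCd
  have hBV0 := BVnorm_nonneg (h ω)
  set B0 := 2 * (K * BVnorm (h ω)) * c with hB0
  have hB0p : 0 ≤ B0 := by positivity
  set G := Cd * ((2 + V) * (K * BVnorm (h ω))) with hG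
  have hGp : 0 ≤ G := by positivity
  have hexp : Tendsto (fun n => Real.exp
      (-∑ j ∈ Finset.range (L n), (ν ω).real (randComp T ω j ⁻¹' A n j))) atTop
      (𝓝 (Real.exp (-Λ))) := by
    refine (Real.continuous_exp.tendsto _).comp (hΛ.neg.congr fun n => ?_)
    congr 1
    refine Finset.sum_congr rfl fun j _ => ?_
    rw [F.hit_eq S ω j (hA n j), Measure.real]
  have hr0 : Tendsto (fun n : ℕ => c / (n:ℝ)) atTop (𝓝[>] 0) := by
    rw [tendsto_nhdsWithin_iff]
    refine ⟨tendsto_const_div_atTop_nhds_zero_nat c, ?_⟩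
    filter_upwards [eventually_ge_atTop 1] with n hn
    have : (0:ℝ) < n := by exact_mod_cast hn
    exact div_pos hc this
  -- vanishing error
  set er : ℕ → ℝ := fun n => C0 * (2 * B0 ^ 2 * ((Nat.sqrt n : ℝ) / n) + G * (n * θ ^ (Nat.sqrt n))
    + B0 ^ 2 * (1 / n)) with her
  have her0 : Tendsto er atTop (𝓝 0) := by
    have := (((sqrt_div_tendsto.const_mul (2 * B0 ^ 2)).add
      ((n_pow_sqrt S.hθ0 S.hθ1).const_mul G)).add
      ((tendsto_const_div_atTop_nhds_zero_nat (1:ℝ)).const_mul (B0 ^ 2))).const_mul C0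
    simpa [her] using this
  have main : ∀ ℓ : ℕ, ∀ᶠ n in atTop, |(ν ω).real (Qs T ω (A n) 0) - Real.exp
      (-∑ j ∈ Finset.range (L n), (ν ω).real (randComp T ω j ⁻¹' A n j))|
      ≤ er n + C0 * (G * (2 * c) * (θ ^ ℓ / (1 - θ))) := by
    intro ℓ
    have hb1 : ∀ᶠ n : ℕ in atTop, B0 * (1 / (n:ℝ)) ≤ 1 := by
      have : Tendsto (fun n : ℕ => B0 * (1 / (n:ℝ))) atTop (𝓝 0) := by
        simpa using (tendsto_const_div_atTop_nhds_zero_nat (1:ℝ)).const_mul B0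
      exact this.eventually (ge_mem_nhds (by norm_num))
    filter_upwards [hr0.eventually (no_return hm T x0 hx0cont hx0np ℓ), hb1,
      eventually_ge_atTop 1] with n hret hb hn
    have hnp : (0:ℝ) < n := by exact_mod_cast hn
    have hst := void_step S F ω x0 (c / n) (by positivity) (hA n) (fun i => hAD n i hn) hV0
      (fun i => hV n i hn)
      ℓ (Nat.sqrt n) (Nat.sqrt_pos.2 hn) hret (B := B0 * (1 / n)) (G := G)
      (by rw [hB0]; ring) hG hb
    have ht := void_tele ν ω hst (L n)
    have hQL : Qs T ω (A n) (L n) = univ := by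
      ext x
      simp only [Qs, mem_ofPred_eq, mem_univ, iff_true]
      intro i hi
      simp [hAL n i hn hi]
    rw [hQL, probReal_univ, mul_one] at ht
    refine ht.trans ?_
    calc _ ≤ (C0 * n) * ((Nat.sqrt n) * (B0 * (1 / n)) ^ 2
          + G * (2 * (c / n)) * (θ ^ ℓ / (1 - θ)) + G * θ ^ (Nat.sqrt n)
          + (Nat.sqrt n) * (B0 * (1 / n)) ^ 2 + (B0 * (1 / n)) ^ 2) := by
          gcongr
          exact hL n
      _ = _ := by
          rw [her]; field_simp; ring
  rw [Metric.tendsto_nhds]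
  intro η hη
  have k1 : Tendsto (fun ℓ : ℕ => C0 * (G * (2 * c) * (θ ^ ℓ / (1 - θ)))) atTop (𝓝 0) := by
    have := tendsto_pow_atTop_nhds_zero_of_lt_one S.hθ0.le S.hθ1
    simpa using (((this.div_const (1 - θ)).const_mul (G * (2 * c)))).const_mul C0
  obtain ⟨ℓ, hℓ⟩ := (k1.eventually (gt_mem_nhds (show 0 < η / 3 by linarith))).exists
  filter_upwards [main ℓ, her0.eventually (gt_mem_nhds (show 0 < η / 3 by linarith)),
    Metric.tendsto_nhds.1 hexp (η / 3) (by linarith)] with n a1 a2 a3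
  rw [Real.dist_eq] at *
  have := abs_sub_le ((ν ω).real (Qs T ω (A n) 0)) (Real.exp
      (-∑ j ∈ Finset.range (L n), (ν ω).real (randComp T ω j ⁻¹' A n j))) (Real.exp (-Λ))
  linarith

end

end

noncomputable section

lemma phi_iff {α x0 b u : ℝ} {v : ℝ≥0∞} (hα : 0 < α) (hb : 0 < b) (hu : 0 < u)
    (huv : ENNReal.ofReal u < v) {n : ℕ} (hn : 1 ≤ n) (x : ℝ) :
    (u < phiObs α x0 x / ((b * (n : ℝ)) ^ α⁻¹) ∧
      ENNReal.ofReal (phiObs α x0 x / ((b * (n : ℝ)) ^ α⁻¹)) ≤ v) ↔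
    x ∈ Dset x0 (u ^ (-α) / b / n) ∧ x ∉ Dset x0 (v.toReal ^ (-α) / b / n) := by
  have hnp : (0:ℝ) < n := by exact_mod_cast hn
  have hbn : 0 < b * (n:ℝ) := by positivity
  by_cases hx : x = x0
  · have h0 : phiObs α x0 x = 0 := by
      rw [phiObs, hx, sub_self, abs_zero, Real.zero_rpow (by simpa using hα.ne')]
    rw [h0, zero_div]
    simp only [mem_Dset, hx]
    constructor
    · rintro ⟨h, _⟩; linarith
    · rintro ⟨h, _⟩; exact absurd rfl h.1
  have hy : 0 < |x - x0| := abs_pos.2 (sub_ne_zero.2 hx)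
  set y := |x - x0| with hyd
  have hz : 0 < y * (b * n) := by positivity
  have hval : phiObs α x0 x / ((b * (n : ℝ)) ^ α⁻¹) = (y * (b * n)) ^ (-α)⁻¹ := by
    rw [phiObs, ← hyd, Real.mul_rpow hy.le hbn.le, inv_neg, Real.rpow_neg hbn.le, div_eq_mul_inv]
  rw [hval]
  simp only [mem_Dset, ← hyd, ne_eq, hx, not_false_eq_true, true_and, not_lt]
  have hα' : -α < 0 := by linarith
  have e1 : (u < (y * (b * n)) ^ (-α)⁻¹) ↔ y < u ^ (-α) / b / n := by
    rw [Real.lt_rpow_inv_iff_of_neg hu hz hα', div_div, lt_div_iff₀ hbn]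
  have e2 : (ENNReal.ofReal ((y * (b * n)) ^ (-α)⁻¹) ≤ v) ↔ v.toReal ^ (-α) / b / n ≤ y := by
    by_cases hv : v = ∞
    · simp only [hv, le_top, ENNReal.toReal_top, true_iff]
      rw [Real.zero_rpow hα'.ne]
      simpa using hy.le
    · have hvp : 0 < v.toReal :=
        ENNReal.toReal_pos (ne_of_gt (lt_of_le_of_lt (by simp) huv)) hv
      rw [ENNReal.ofReal_le_iff_le_toReal hv, Real.rpow_inv_le_iff_of_neg hz hvp hα', div_div,
        div_le_iff₀ hbn]
  rw [e1, e2]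

lemma radii {α b u : ℝ} {v : ℝ≥0∞} (hα : 0 < α) (hb : 0 < b) (hu : 0 < u)
    (huv : ENNReal.ofReal u < v) :
    0 ≤ v.toReal ^ (-α) / b ∧ v.toReal ^ (-α) / b ≤ u ^ (-α) / b := by
  refine ⟨div_nonneg (Real.rpow_nonneg ENNReal.toReal_nonneg _) hb.le, ?_⟩
  refine div_le_div_of_nonneg_right ?_ hb.le
  by_cases hv : v = ∞
  · rw [hv, ENNReal.toReal_top, Real.zero_rpow (by linarith)]
    positivity
  · refine Real.rpow_le_rpow_of_nonpos hu ?_ (by linarith)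
    exact (ENNReal.ofReal_le_iff_le_toReal hv).1 huv.le

/-- elementary target set at index `j` -/
def Bs (x0 : ℝ) (n j : ℕ) (s t a d : ℝ) : Set ℝ :=
  {x | (s < ((j + 1 : ℕ) : ℝ) / n ∧ ((j + 1 : ℕ) : ℝ) / n ≤ t) ∧
    (x ∈ Dset x0 (a / n) ∧ x ∉ Dset x0 (d / n))}

lemma Bs_pos {x0 : ℝ} {n j : ℕ} {s t a d : ℝ}
    (h : s < ((j + 1 : ℕ) : ℝ) / n ∧ ((j + 1 : ℕ) : ℝ) / n ≤ t) :
    Bs x0 n j s t a d = Dset x0 (a / n) \ Dset x0 (d / n) := by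
  ext x; simp only [Bs, mem_ofPred_eq, Set.mem_sdiff, h]; simp

lemma Bs_neg {x0 : ℝ} {n j : ℕ} {s t a d : ℝ}
    (h : ¬ (s < ((j + 1 : ℕ) : ℝ) / n ∧ ((j + 1 : ℕ) : ℝ) / n ≤ t)) :
    Bs x0 n j s t a d = ∅ := by
  ext x; simp only [Bs, mem_ofPred_eq, h]; simp

lemma Bs_meas (x0 : ℝ) (n j : ℕ) (s t a d : ℝ) : MeasurableSet (Bs x0 n j s t a d) := by
  by_cases h : s < ((j + 1 : ℕ) : ℝ) / n ∧ ((j + 1 : ℕ) : ℝ) / n ≤ t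
  · rw [Bs_pos h]; exact (measurableSet_Dset _ _).diff (measurableSet_Dset _ _)
  · rw [Bs_neg h]; exact MeasurableSet.empty

lemma ind_diff {x0 r r' : ℝ} (h : r' ≤ r) :
    ind (Dset x0 r \ Dset x0 r') = fun x => ind (Dset x0 r) x - ind (Dset x0 r') x := by
  ext x
  have := @Dset_mono x0 _ _ h x
  by_cases h1 : x ∈ Dset x0 r' <;> by_cases h2 : x ∈ Dset x0 r
  · simp [ind, indicator, h1, h2]
  · exact absurd (this h1) h2
  · simp [ind, indicator, h1, h2]
  · simp [ind, indicator, h1, h2]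

lemma Bs_var (x0 : ℝ) (n j : ℕ) (s t a d : ℝ) (had : d ≤ a) :
    eVariationOn ((Bs x0 n j s t a d).indicator (fun _ => (1:ℝ))) (Icc 0 1) ≤ 8 := by
  by_cases h : s < ((j + 1 : ℕ) : ℝ) / n ∧ ((j + 1 : ℕ) : ℝ) / n ≤ t
  · rw [Bs_pos h]
    have := ind_diff (x0 := x0) (div_le_div_of_nonneg_right had (Nat.cast_nonneg n))
    rw [show (Dset x0 (a / n) \ Dset x0 (d / n)).indicator (fun _ => (1:ℝ)) = _ from this]
    refine (eVar_sub_le _ _ _).trans ((add_le_add (eVar_Dset_le _ _) (eVar_Dset_le _ _)).trans ?_)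
    norm_num
  · rw [Bs_neg h]
    have : (∅ : Set ℝ).indicator (fun _ => (1:ℝ)) = fun _ => 0 := by simp
    rw [this, eVar_const]
    simp

lemma act_iff {s t : ℝ} (hs : 0 ≤ s) (ht : 0 ≤ t) {n : ℕ} (hn : 1 ≤ n) (j : ℕ) :
    (s < ((j + 1 : ℕ) : ℝ) / n ∧ ((j + 1 : ℕ) : ℝ) / n ≤ t) ↔ ⌊s * n⌋₊ ≤ j ∧ j < ⌊t * n⌋₊ := by
  have hnp : (0:ℝ) < n := by exact_mod_cast hn
  rw [lt_div_iff₀ hnp, div_le_iff₀ hnp, ← Nat.floor_lt (by positivity),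
    ← Nat.le_floor_iff (by positivity)]
  omega

section
variable {m : ℕ} {T : Fin m → ℝ → ℝ} {Pop : Fin m → (ℝ → ℝ) → ℝ → ℝ} {K Cd θ : ℝ}
  {h : Om m → ℝ → ℝ} {ν : Om m → Measure ℝ}

lemma hit_diff (S : Sys T Pop K Cd θ) (ω : Om m) (f : ℝ → ℝ) (hf : IsBV f) (j : ℕ) (x0 : ℝ)
    {r r' : ℝ} (hr : r' ≤ r) :
    hit T ω f j (Dset x0 r \ Dset x0 r')
      = hit T ω f j (Dset x0 r) - hit T ω f j (Dset x0 r') := by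
  have hi : ∀ A : Set ℝ, MeasurableSet A →
      Integrable (fun x => ind A (randComp T ω j x) * f x) mLeb := by
    intro A hA
    obtain ⟨C, hC⟩ := ind_bdd A
    exact hf.1.bdd_mul (c := C)
      ((ind_meas hA).comp (randComp_measurable S.Tmeas ω j)).aestronglyMeasurable
      (ae_of_all _ fun x => hC _)
  rw [hit, ind_diff hr, hit, hit,
    ← integral_sub (hi _ (measurableSet_Dset _ _)) (hi _ (measurableSet_Dset _ _))]
  congr 1; ext x; ring

lemma Bs_sum (S : Sys T Pop K Cd θ) (ω : Om m) (f : ℝ → ℝ) (hf : IsBV f) (x0 b : ℝ)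
    (hint : ∀ c t : ℝ, 0 ≤ c → 0 ≤ t → Tendsto (fun n : ℕ =>
      ∑ j ∈ Finset.range ⌊t * n⌋₊, hit T ω f j (Dset x0 (c / n))) atTop (𝓝 (t * c * b)))
    {s t a d τ : ℝ} (hs : 0 ≤ s) (hst : s < t) (htτ : t ≤ τ) (hd : 0 ≤ d) (had : d ≤ a) :
    Tendsto (fun n : ℕ => ∑ j ∈ Finset.range ⌊τ * n⌋₊, hit T ω f j (Bs x0 n j s t a d)) atTop
      (𝓝 ((t - s) * ((a - d) * b))) := by
  have ht : 0 ≤ t := hs.trans hst.le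
  have ha : 0 ≤ a := hd.trans had
  have key := ((hint a t ha ht).sub (hint d t hd ht)).sub ((hint a s ha hs).sub (hint d s hd hs))
  have e : t * a * b - t * d * b - (s * a * b - s * d * b) = (t - s) * ((a - d) * b) := by ring
  rw [e] at key
  refine key.congr' ?_
  filter_upwards [eventually_ge_atTop 1] with n hn
  have hnp : (0:ℝ) < n := by exact_mod_cast hn
  have hdr : d / (n:ℝ) ≤ a / n := by gcongr
  set w : ℕ → ℝ := fun j => hit T ω f j (Dset x0 (a / n)) - hit T ω f j (Dset x0 (d / n)) with hw
  have h1 : ∀ j, hit T ω f j (Bs x0 n j s t a d)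
      = if ⌊s * n⌋₊ ≤ j ∧ j < ⌊t * n⌋₊ then w j else 0 := by
    intro j
    by_cases hj : ⌊s * n⌋₊ ≤ j ∧ j < ⌊t * n⌋₊
    · rw [if_pos hj, Bs_pos ((act_iff hs ht hn j).2 hj), hit_diff S ω f hf j x0 hdr]
    · rw [if_neg hj, Bs_neg (fun hh => hj ((act_iff hs ht hn j).1 hh))]
      simp [hit, ind]
  simp only [h1]
  rw [← Finset.sum_filter]
  have h2 : (Finset.range ⌊τ * (n:ℝ)⌋₊).filter (fun j => ⌊s * n⌋₊ ≤ j ∧ j < ⌊t * n⌋₊)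
      = Finset.Ico ⌊s * n⌋₊ ⌊t * n⌋₊ := by
    ext j
    have : ⌊t * (n:ℝ)⌋₊ ≤ ⌊τ * n⌋₊ := Nat.floor_le_floor (by gcongr)
    simp only [Finset.mem_filter, Finset.mem_range, Finset.mem_Ico]
    omega
  rw [h2, Finset.sum_Ico_eq_sub _ (Nat.floor_le_floor (by gcongr))]
  simp only [hw, Finset.sum_sub_distrib]

/-- Abstract assembly: a finite family of elementary sets. -/
lemma assembly (hm : 1 ≤ m) (S : Sys T Pop K Cd θ) (F : Fam Pop h ν) (ω : Om m) (x0 b : ℝ)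
    (hx0cont : ∀ (ω : Om m) (n : ℕ), 1 ≤ n → ContinuousAt (randComp T ω n) x0)
    (hx0np : ∀ (ω : Om m) (n : ℕ), 1 ≤ n → randComp T ω n x0 ≠ x0)
    (hint : ∀ c t : ℝ, 0 ≤ c → 0 ≤ t → Tendsto (fun n : ℕ =>
      ∑ j ∈ Finset.range ⌊t * n⌋₊, hit T ω (h ω) j (Dset x0 (c / n))) atTop (𝓝 (t * c * b)))
    {ι : Type} [Fintype ι] (s t a d : ι → ℝ) (hs : ∀ i, 0 ≤ s i) (hst : ∀ i, s i < t i)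
    (hd : ∀ i, 0 ≤ d i) (had : ∀ i, d i ≤ a i)
    (hdisj : ∀ n : ℕ, 1 ≤ n → ∀ j : ℕ, ∀ i i', i ≠ i' → ∀ x,
      x ∈ Bs x0 n j (s i) (t i) (a i) (d i) → x ∉ Bs x0 n j (s i') (t i') (a i') (d i'))
    (R : ℕ → ℕ → ℝ → Prop)
    (hR : ∀ n : ℕ, 1 ≤ n → ∀ j : ℕ, ∀ y, R n (j + 1) y ↔
      ∃ i, y ∈ Bs x0 n j (s i) (t i) (a i) (d i)) :
    Tendsto (fun n : ℕ => ((ν ω) {x | Set.ncard {j : ℕ | 1 ≤ j ∧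
        R n j (randComp T ω (j - 1) x)} = 0}).toReal) atTop
        (𝓝 (Real.exp (-∑ i, (t i - s i) * ((a i - d i) * b)))) ∧
    Tendsto (fun n : ℕ => ∫ x, (Set.ncard {j : ℕ | 1 ≤ j ∧
        R n j (randComp T ω (j - 1) x)} : ℝ) ∂(ν ω)) atTop
        (𝓝 (∑ i, (t i - s i) * ((a i - d i) * b))) := by
  classical
  have hpr := F.prob
  have ht : ∀ i, 0 ≤ t i := fun i => (hs i).trans (hst i).le
  have ha : ∀ i, 0 ≤ a i := fun i => (hd i).trans (had i)
  set τ := ∑ i, t i with hτ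
  have hτ0 : 0 ≤ τ := Finset.sum_nonneg fun i _ => ht i
  have htτ : ∀ i, t i ≤ τ := fun i =>
    Finset.single_le_sum (f := t) (fun i _ => ht i) (Finset.mem_univ i)
  set c := ∑ i, a i + 1 with hcdef
  have hc : 0 < c := by
    have : 0 ≤ ∑ i, a i := Finset.sum_nonneg fun i _ => ha i
    linarith
  have hac : ∀ i, a i ≤ c := fun i => by
    have := Finset.single_le_sum (f := a) (fun i _ => ha i) (Finset.mem_univ i)
    linarith
  set A : ℕ → ℕ → Set ℝ := fun n j => ⋃ i ∈ Finset.univ, Bs x0 n j (s i) (t i) (a i) (d i)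
    with hA
  have memA : ∀ n j x, x ∈ A n j ↔ ∃ i, x ∈ Bs x0 n j (s i) (t i) (a i) (d i) := by
    intro n j x; simp [hA]
  have hAm : ∀ n j, MeasurableSet (A n j) := fun n j =>
    Finset.measurableSet_biUnion _ fun i _ => Bs_meas _ _ _ _ _ _ _
  have hAind : ∀ n j, 1 ≤ n → ind (A n j)
      = fun x => ∑ i, ind (Bs x0 n j (s i) (t i) (a i) (d i)) x := by
    intro n j hn
    refine Finset.indicator_biUnion _ _ ?_
    intro i _ i' _ hii
    exact Set.disjoint_left.2 fun x => hdisj n hn j i i' hii x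
  set L : ℕ → ℕ := fun n => ⌊τ * (n:ℝ)⌋₊ with hL
  have hAL : ∀ n i, 1 ≤ n → L n ≤ i → A n i = ∅ := by
    intro n j hn hj
    ext x
    rw [memA]
    simp only [mem_empty_iff_false, iff_false, not_exists]
    intro i
    rw [Bs_neg]; · simp
    rw [act_iff (hs i) (ht i) hn]
    have : ⌊t i * (n:ℝ)⌋₊ ≤ ⌊τ * n⌋₊ :=
      Nat.floor_le_floor (mul_le_mul_of_nonneg_right (htτ i) (Nat.cast_nonneg n))
    simp only [hL] at hj
    omega
  have hhit : ∀ n j, 1 ≤ n → hit T ω (h ω) j (A n j)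
      = ∑ i, hit T ω (h ω) j (Bs x0 n j (s i) (t i) (a i) (d i)) := by
    intro n j hn
    simp only [hit]
    rw [hAind n j hn, ← integral_finsetSum]
    · congr 1; ext x; rw [Finset.sum_mul]
    · intro i _
      obtain ⟨C, hC⟩ := ind_bdd (Bs x0 n j (s i) (t i) (a i) (d i))
      exact (F.bv ω).1.bdd_mul (c := C) ((ind_meas (Bs_meas _ _ _ _ _ _ _)).comp
        (randComp_measurable S.Tmeas ω j)).aestronglyMeasurable (ae_of_all _ fun x => hC _)
  have hΛ : Tendsto (fun n => ∑ j ∈ Finset.range (L n), hit T ω (h ω) j (A n j)) atTop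
      (𝓝 (∑ i, (t i - s i) * ((a i - d i) * b))) := by
    have := tendsto_finsetSum Finset.univ fun i (_ : i ∈ Finset.univ) =>
      Bs_sum S ω (h ω) (F.bv ω) x0 b hint (hs i) (hst i) (htτ i) (hd i) (had i)
    refine this.congr' ?_
    filter_upwards [eventually_ge_atTop 1] with n hn
    rw [Finset.sum_comm]
    exact Finset.sum_congr rfl fun j _ => (hhit n j hn).symm
  -- counting
  have hcount : ∀ n, 1 ≤ n → ∀ x, Set.ncard {j : ℕ | 1 ≤ j ∧ R n j (randComp T ω (j - 1) x)}
      = ((Finset.range (L n)).filter (fun j => randComp T ω j x ∈ A n j)).card := by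
    intro n hn x
    have e : {j : ℕ | 1 ≤ j ∧ R n j (randComp T ω (j - 1) x)}
        = Nat.succ '' ((Finset.range (L n)).filter (fun j => randComp T ω j x ∈ A n j) : Set ℕ) := by
      ext j
      simp only [mem_ofPred_eq, mem_image, Finset.coe_filter, Finset.mem_range]
      constructor
      · rintro ⟨hj, hR'⟩
        obtain ⟨j', rfl⟩ : ∃ j', j = j' + 1 := ⟨j - 1, by omega⟩
        rw [Nat.add_sub_cancel, hR n hn, ← memA] at hR'
        refine ⟨j', ⟨?_, hR'⟩, rfl⟩
        by_contra hcon
        rw [hAL n j' hn (not_lt.1 hcon)] at hR'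
        exact hR'
      · rintro ⟨j', ⟨_, hj'⟩, rfl⟩
        refine ⟨by omega, ?_⟩
        rw [Nat.succ_eq_add_one, Nat.add_sub_cancel, hR n hn, ← memA]
        exact hj'
    rw [e, Set.ncard_image_of_injective _ Nat.succ_injective, Set.ncard_coe_finset]
  constructor
  · have hv := void_limit hm S F ω x0 hx0cont hx0np A hAm c hc (by
      intro n j hn x hx
      obtain ⟨i, hi⟩ := (memA n j x).1 hx
      exact Dset_mono x0 (div_le_div_of_nonneg_right (hac i) (Nat.cast_nonneg n)) hi.2.1)
      (V := ∑ _i : ι, 8) (by positivity) (by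
        intro n j hn
        rw [show (A n j).indicator (fun _ => (1:ℝ)) = _ from hAind n j hn]
        refine (eVar_sum_le _ _ _).trans ?_
        refine (Finset.sum_le_sum fun i _ => Bs_var x0 n j _ _ _ _ (had i)).trans ?_
        rw [ENNReal.ofReal_sum_of_nonneg (fun _ _ => by norm_num)]
        refine Finset.sum_le_sum fun i _ => ?_
        simp)
      L τ hτ0 (fun n => Nat.floor_le (by positivity)) hAL _ hΛ
    refine hv.congr' ?_
    filter_upwards [eventually_ge_atTop 1] with n hn
    rw [Measure.real]
    congr 2
    ext x
    simp only [Qs, mem_ofPred_eq]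
    rw [hcount n hn x, Finset.card_eq_zero, Finset.filter_eq_empty_iff]
    constructor
    · intro hx j _; exact hx j (Nat.zero_le _)
    · intro hx j _ hj
      by_cases hjL : j < L n
      · exact hx (Finset.mem_range.2 hjL) hj
      · rw [hAL n j hn (not_lt.1 hjL)] at hj; exact hj
  · refine hΛ.congr' ?_
    filter_upwards [eventually_ge_atTop 1] with n hn
    have e : ∀ x, (Set.ncard {j : ℕ | 1 ≤ j ∧ R n j (randComp T ω (j - 1) x)} : ℝ)
        = ∑ j ∈ Finset.range (L n), (randComp T ω j ⁻¹' A n j).indicator (1 : ℝ → ℝ) x := by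
      intro x
      rw [hcount n hn x, Finset.card_filter]
      push_cast
      refine Finset.sum_congr rfl fun j _ => ?_
      simp [indicator]
    simp only [e]
    rw [integral_finsetSum]
    · refine Finset.sum_congr rfl fun j _ => ?_
      rw [integral_indicator_one (randComp_measurable S.Tmeas ω j (hAm n j)),
        F.hit_eq S ω j (hAm n j), Measure.real]
    · intro j _
      exact (integrable_const (1:ℝ)).indicator (randComp_measurable S.Tmeas ω j (hAm n j))

end

end

theorem stmt17 (m : ℕ) (hm : 1 ≤ m) (T : Fin m → ℝ → ℝ) (lam : ℝ) (hlam : 1 < lam)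
    (hT : ∀ i, PiecewiseC2Expanding (T i) lam)
    (hmaps : ∀ i, Set.MapsTo (T i) (Set.Icc 0 1) (Set.Icc 0 1))
    (hTmeas : ∀ i, Measurable (T i))
    -- the transfer operators with respect to Lebesgue measure, defined by duality
    (Pop : Fin m → (ℝ → ℝ) → ℝ → ℝ)
    (hdual : ∀ (i : Fin m) (f : ℝ → ℝ), Integrable f mLeb →
      ∀ g : ℝ → ℝ, Measurable g → (∃ Cg : ℝ, ∀ x, |g x| ≤ Cg) →
        ∫ x, g (T i x) * f x ∂mLeb = ∫ x, g x * Pop i f x ∂mLeb)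
    (hPopBV : ∀ (i : Fin m) (f : ℝ → ℝ), IsBV f → IsBV (Pop i f))
    -- (LY): uniform Lasota–Yorke inequalities
    (r : ℕ) (hr : 1 ≤ r) (M D : ℝ) (hM : 0 < M) (hD : 0 < D)
    (ρ : ℝ) (hρ : ρ ∈ Set.Ioo (0 : ℝ) 1)
    (hLY1 : ∀ (ω : Om m) (f : ℝ → ℝ), IsBV f → BVnorm (Pop (ω 0) f) ≤ M * BVnorm f)
    (hLY2 : ∀ (ω : Om m) (f : ℝ → ℝ), IsBV f →
      var (Pcomp Pop ω r f) ≤ ρ * var f + D * ∫ x, |f x| ∂mLeb)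
    -- (Dec): exponential decay on mean-zero BV functions
    (Cdec : ℝ) (hCdec : 0 < Cdec) (θ : ℝ) (hθ : θ ∈ Set.Ioo (0 : ℝ) 1)
    (hDec : ∀ (n : ℕ), 1 ≤ n → ∀ (ω : Om m) (f : ℝ → ℝ), IsBV f →
      (∫ x, f x ∂mLeb) = 0 → BVnorm (Pcomp Pop ω n f) ≤ Cdec * θ ^ n * BVnorm f)
    -- (Min): uniform lower bound
    (cmin : ℝ) (hcmin : 0 < cmin)
    (hMin : ∀ (n : ℕ), 1 ≤ n → ∀ (ω : Om m), ∀ x ∈ Set.Icc (0 : ℝ) 1,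
      cmin ≤ Pcomp Pop ω n (fun _ => 1) x)
    -- `P` is the Bernoulli product measure `(p_1, …, p_m)^{⊗ℤ}`
    (p : Fin m → ℝ) (hp : ∀ i, 0 < p i) (hp1 : ∑ i, p i = 1)
    (P : Measure (Om m)) (hPprob : IsProbabilityMeasure P)
    (hP : ∀ (s : Finset ℤ) (f : ℤ → Fin m),
      P {ω | ∀ i ∈ s, ω i = f i} = ENNReal.ofReal (∏ i ∈ s, p (f i)))
    -- the equivariant family of BV probability densities and the quenched measures `ν^ω`
    (h : Om m → ℝ → ℝ) (hBV : ∀ ω, IsBV (h ω))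
    (hequi : ∀ ω : Om m, Pop (ω 0) (h ω) =ᵐ[mLeb] h (shift ω))
    (hprobd : ∀ ω, (∀ᵐ x ∂mLeb, 0 ≤ h ω x) ∧ ∫ x, h ω x ∂mLeb = 1)
    (ν : Om m → Measure ℝ)
    (hν : ∀ ω, ν ω = mLeb.withDensity (fun x => ENNReal.ofReal (h ω x)))
    -- the annealed (stationary) measure `ν(A) = ∫ ν^ω(A) d𝐏(ω)`
    (νa : Measure ℝ)
    (hνa : ∀ A : Set ℝ, MeasurableSet A → νa A = ∫⁻ ω, ν ω A ∂P)
    -- `α ∈ (0,2)` and `x0` non-periodic and outside all discontinuities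
    (α : ℝ) (hα : α ∈ Set.Ioo (0 : ℝ) 2)
    (x0 : ℝ) (hx0 : x0 ∈ Set.Icc (0 : ℝ) 1)
    (hx0cont : ∀ (ω : Om m) (n : ℕ), 1 ≤ n → ContinuousAt (randComp T ω n) x0)
    (hx0np : ∀ (ω : Om m) (n : ℕ), 1 ≤ n → randComp T ω n x0 ≠ x0)
    -- `R = ⋃_{i=1}^k (s_i, t_i] × J_i`, a finite union of disjoint rectangles
    (k : ℕ) (hk : 1 ≤ k) (ss tt : Fin k → ℝ)
    (hss : ∀ i, 0 ≤ ss i) (hstt : ∀ i, ss i < tt i)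
    (q : Fin k → ℕ) (hq : ∀ i, 1 ≤ q i)
    (u : ∀ i, Fin (q i) → ℝ) (v : ∀ i, Fin (q i) → ℝ≥0∞)
    (hu : ∀ i l, 0 < u i l) (huv : ∀ i l, ENNReal.ofReal (u i l) < v i l)
    -- each `J_i` is a disjoint union of intervals
    (hJdisj : ∀ i, ∀ l l', l ≠ l' → ∀ y : ℝ,
      ¬((u i l < y ∧ ENNReal.ofReal y ≤ v i l) ∧ (u i l' < y ∧ ENNReal.ofReal y ≤ v i l')))
    -- the rectangles are pairwise disjoint
    (hRdisj : ∀ i i', i ≠ i' → ∀ τ y : ℝ,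
      ¬((ss i < τ ∧ τ ≤ tt i ∧ memJ (u i) (v i) y) ∧
        (ss i' < τ ∧ τ ≤ tt i' ∧ memJ (u i') (v i') y))) :
    ∃ b : ℝ, 0 < b ∧
      Tendsto (fun ε : ℝ => (νa {x | |x - x0| < ε}).toReal / ε) (𝓝[>] (0 : ℝ)) (𝓝 b) ∧
      ∀ᵐ ω ∂P,
        -- (a): convergence of the void probabilities
        Tendsto (fun n : ℕ =>
          ((ν ω) {x | Set.ncard {j : ℕ | 1 ≤ j ∧
            inRect k ss tt q u v ((j : ℝ) / (n : ℝ))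
              (phiObs α x0 (randComp T ω (j - 1) x) / ((b * (n : ℝ)) ^ α⁻¹))} = 0}).toReal)
          atTop (𝓝 (Real.exp (-(∑ i, (tt i - ss i) * PiAlpha α (u i) (v i))))) ∧
        -- (b): convergence of the expected number of points
        Tendsto (fun n : ℕ =>
          ∫ x, (Set.ncard {j : ℕ | 1 ≤ j ∧
            inRect k ss tt q u v ((j : ℝ) / (n : ℝ))
              (phiObs α x0 (randComp T ω (j - 1) x) / ((b * (n : ℝ)) ^ α⁻¹))} : ℝ)
            ∂(ν ω))
          atTop (𝓝 (∑ i, (tt i - ss i) * PiAlpha α (u i) (v i))) := by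
  have hα0 : 0 < α := hα.1
  obtain ⟨K, hK1, hK⟩ := exists_K hTmeas hdual hPopBV r hr M D hM hD ρ hρ hLY1 hLY2
  have S : Sys T Pop K Cdec θ := ⟨hTmeas, hdual, hPopBV, hK1, hK, hCdec, hθ.1, hθ.2, hDec⟩
  have F : Fam Pop h ν := ⟨hBV, hequi, fun ω => (hprobd ω).1, fun ω => (hprobd ω).2, hν⟩
  have hC : Cyl p P := hP
  obtain ⟨b, hb, hlim, hLNb⟩ := exists_b S F hm hp hp1 hC hνa hcmin hMin x0 hx0
  refine ⟨b, hb, hlim, ?_⟩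
  have hsl : ∀ᵐ ω ∂P, ∀ N : ℕ, 1 ≤ N →
      Tendsto (fun n : ℕ => (∑ j ∈ Finset.range n, LN T x0 N (sh j ω)) / n)
        atTop (𝓝 (∫ ω, LN T x0 N ω ∂P)) := by
    rw [ae_all_iff]
    intro N
    by_cases hN : 1 ≤ N
    · filter_upwards [slln hm hp hp1 hC hN (LN_dep T x0 N)] with ω hω _ using hω
    · exact ae_of_all _ fun ω h1 => absurd h1 hN
  filter_upwards [hsl] with ω hω
  have hint := fun c t hc ht => intensity hm S ω (h ω) (hBV ω) (hprobd ω).2 x0 hx0 _ b hLNb hω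
    c t hc ht
  have hBmem : ∀ n : ℕ, 1 ≤ n → ∀ (j : ℕ) (i : Fin k) (l : Fin (q i)) (y : ℝ),
      y ∈ Bs x0 n j (ss i) (tt i) ((u i l) ^ (-α) / b) ((v i l).toReal ^ (-α) / b) ↔
      (ss i < ((j + 1 : ℕ) : ℝ) / n ∧ ((j + 1 : ℕ) : ℝ) / n ≤ tt i) ∧
      (u i l < phiObs α x0 y / ((b * (n : ℝ)) ^ α⁻¹) ∧
      ENNReal.ofReal (phiObs α x0 y / ((b * (n : ℝ)) ^ α⁻¹)) ≤ v i l) := by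
    intro n hn j i l y
    rw [phi_iff hα0 hb (hu i l) (huv i l) hn]
    rfl
  have key := assembly hm S F ω x0 b hx0cont hx0np hint (ι := (Σ i : Fin k, Fin (q i)))
    (fun z => ss z.1) (fun z => tt z.1) (fun z => (u z.1 z.2) ^ (-α) / b)
    (fun z => (v z.1 z.2).toReal ^ (-α) / b) (fun z => hss _) (fun z => hstt _)
    (fun z => (radii hα0 hb (hu _ _) (huv _ _)).1) (fun z => (radii hα0 hb (hu _ _) (huv _ _)).2)
    (by
      rintro n hn j ⟨i, l⟩ ⟨i', l'⟩ hne y hy hy'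
      rw [hBmem n hn] at hy hy'
      by_cases hii : i = i'
      · subst hii
        refine hJdisj i l l' (fun hl => hne (by rw [hl])) _ ⟨hy.2, hy'.2⟩
      · exact hRdisj i i' hii _ _ ⟨⟨hy.1.1, hy.1.2, l, hy.2⟩, ⟨hy'.1.1, hy'.1.2, l', hy'.2⟩⟩)
    (fun n j y => inRect k ss tt q u v ((j : ℝ) / (n : ℝ))
      (phiObs α x0 y / ((b * (n : ℝ)) ^ α⁻¹)))
    (by
      intro n hn j y
      constructor
      · rintro ⟨i, h1, h2, l, h3⟩
        exact ⟨⟨i, l⟩, (hBmem n hn j i l y).2 ⟨⟨h1, h2⟩, h3⟩⟩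
      · rintro ⟨⟨i, l⟩, hy⟩
        have h1 := (hBmem n hn j i l y).1 hy
        exact ⟨i, h1.1.1, h1.1.2, l, h1.2⟩)
  have hsum : ∑ z : (Σ i : Fin k, Fin (q i)), (tt z.1 - ss z.1) *
      (((u z.1 z.2) ^ (-α) / b - (v z.1 z.2).toReal ^ (-α) / b) * b)
      = ∑ i, (tt i - ss i) * PiAlpha α (u i) (v i) := by
    rw [Fintype.sum_sigma]
    refine Finset.sum_congr rfl fun i _ => ?_
    rw [PiAlpha, Finset.mul_sum]
    refine Finset.sum_congr rfl fun l _ => ?_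
    field_simp
  rw [hsum] at key
  exact key
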